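/- Let A ⊆ ℝ² be any set with Hausdorff dimension dimH(A) = t ∈ [1,2]. Then for a.e. e ∈ S¹ the heavy part satisfies dimH(H(A,e)) ≤ min{3−t, t}, where H(A,e) := {z ∈ A : dimH(A ∩ ℓ_{e,z}) > t−1}. -/

import Mathlib

open MeasureTheory Metric Set
open scoped ENNReal NNReal

noncomputable section

/-- The Euclidean plane ℝ². -/
abbrev Plane := EuclideanSpace ℝ (Fin 2)

/-- The unit circle S¹ ⊆ ℝ². -/
def unitCircle : Set Plane := Metric.sphere (0 : Plane) 1

/-- The line `ℓ_{e,z} = z + span(e)` through `z` in direction `e`. -/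
def lineThrough (e z : Plane) : Set Plane := {w | ∃ r : ℝ, w = z + r • e}


namespace Heavy

lemma kernel_halfcircle (K : ℝ → ℝ) (hc : Continuous K) (hi : Integrable K) (a : ℝ) (ha : 0 < a)
    (hs : ∀ x, a ≤ |x| → K x = 0) (B : ℝ) (hB : ∀ x, |K x| ≤ B)
    (h0 : ∀ R, a ≤ R → ∫ x in (-R)..R, K x = 0) :
    ∃ C : ℝ, 0 ≤ C ∧ ∀ R, 0 ≤ R →
      |∫ τ in (-(Real.pi/2))..(Real.pi/2), K (R * Real.sin τ)| ≤ C / (1 + R)^3 := by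
  have hB0 : 0 ≤ B := (abs_nonneg _).trans (hB 0)
  set I := ∫ x, |K x| with hI
  have hI0 : 0 ≤ I := integral_nonneg (fun x => abs_nonneg _)
  set m := max a 1 with hm
  have hm1 : 1 ≤ m := le_max_right _ _
  have ham : a ≤ m := le_max_left _ _
  have hpi := Real.pi_pos
  refine ⟨B * Real.pi * (1 + m)^3 + 8 * (a^2 * I + a^4 * B * Real.pi), by positivity, ?_⟩
  intro R hR
  rcases le_total R m with h | h
  · have h1 : |∫ τ in (-(Real.pi/2))..(Real.pi/2), K (R * Real.sin τ)| ≤ B * Real.pi := by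
      have := intervalIntegral.norm_integral_le_of_norm_le_const (a := -(Real.pi/2)) (b := Real.pi/2)
        (f := fun τ => K (R * Real.sin τ)) (C := B) (fun x _ => hB _)
      rw [Real.norm_eq_abs] at this
      refine this.trans (le_of_eq ?_)
      rw [show Real.pi/2 - -(Real.pi/2) = Real.pi by ring, abs_of_pos hpi]
    refine h1.trans ?_
    rw [le_div_iff₀ (by positivity)]
    have : (1 + R)^3 ≤ (1+m)^3 := by gcongr
    have h2 : B * Real.pi * (1+R)^3 ≤ B * Real.pi * (1+m)^3 := by gcongr
    have : 0 ≤ 8 * (a^2 * I + a^4 * B * Real.pi) := by positivity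
    linarith
  · have hR1 : 1 ≤ R := hm1.trans h
    have hRa : a ≤ R := ham.trans h
    have hR0 : 0 < R := by linarith
    have cv : ∀ g : ℝ → ℝ, Continuous g →
        ∫ τ in (-(Real.pi/2))..(Real.pi/2), g (R * Real.sin τ) * Real.cos τ
          = R⁻¹ * ∫ x in (-R)..R, g x := by
      intro g hg
      have h1 := intervalIntegral.integral_comp_mul_deriv (a := -(Real.pi/2)) (b := Real.pi/2)
        (f := fun τ => R * Real.sin τ) (f' := fun τ => R * Real.cos τ) (g := g)
        (fun x _ => (Real.hasDerivAt_sin x).const_mul R) (by fun_prop) hg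
      simp only [Function.comp, Real.sin_neg, Real.sin_pi_div_two, mul_one, mul_neg] at h1
      rw [← h1, ← intervalIntegral.integral_const_mul]
      congr 1
      ext τ
      field_simp
    have e1 : ∫ τ in (-(Real.pi/2))..(Real.pi/2), K (R * Real.sin τ)
        = ∫ τ in (-(Real.pi/2))..(Real.pi/2), K (R * Real.sin τ) * (1 - Real.cos τ) := by
      have := cv K hc
      rw [h0 R hRa, mul_zero] at this
      simp only [mul_sub, mul_one]
      rw [intervalIntegral.integral_sub, this, sub_zero]
      · exact (by fun_prop : Continuous fun τ => K (R * Real.sin τ)).intervalIntegrable _ _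
      · exact (by fun_prop : Continuous fun τ => K (R * Real.sin τ) * Real.cos τ).intervalIntegrable _ _
    have key : ∀ τ ∈ Icc (-(Real.pi/2)) (Real.pi/2), |K (R * Real.sin τ) * (1 - Real.cos τ)| ≤
        (a/R)^2 * (|K (R * Real.sin τ)| * Real.cos τ) + (a/R)^4 * B := by
      intro τ hτ
      have hcos : 0 ≤ Real.cos τ := Real.cos_nonneg_of_mem_Icc hτ
      have hcos1 := Real.cos_le_one τ
      have hsq := Real.sin_sq_add_cos_sq τ
      rw [abs_mul, abs_of_nonneg (by linarith : 0 ≤ 1 - Real.cos τ)]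
      by_cases hx : a ≤ |R * Real.sin τ|
      · rw [hs _ hx]; simp; positivity
      · push Not at hx
        have hsin : (Real.sin τ)^2 ≤ (a/R)^2 := by
          rw [div_pow, le_div_iff₀ (by positivity)]
          have := sq_lt_sq' (by linarith [neg_abs_le (R * Real.sin τ), abs_nonneg (R * Real.sin τ)]) hx
          rw [sq_abs] at this
          nlinarith
        have h1 : 1 - Real.cos τ ≤ (a/R)^2 := by nlinarith
        have hk := hB (R * Real.sin τ)
        have hk0 := abs_nonneg (K (R * Real.sin τ))
        set X := |K (R * Real.sin τ)|
        set q := (a/R)^2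
        have hq : (a/R)^4 = q * q := by simp only [q]; ring
        rw [hq]
        have hq0 : 0 ≤ q := by positivity
        calc X * (1 - Real.cos τ) ≤ X * q := by gcongr
          _ = q * (X * Real.cos τ) + q * (X * (1 - Real.cos τ)) := by ring
          _ ≤ q * (X * Real.cos τ) + q * (B * q) := by gcongr
          _ = _ := by ring
    have e2 : |∫ τ in (-(Real.pi/2))..(Real.pi/2), K (R * Real.sin τ)| ≤
        (a/R)^2 * (R⁻¹ * I) + (a/R)^4 * B * Real.pi := by
      rw [e1]
      have hle : -(Real.pi/2) ≤ Real.pi/2 := by linarith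
      refine (intervalIntegral.abs_integral_le_integral_abs hle).trans ?_
      have hmono := intervalIntegral.integral_mono_on (μ := volume) hle
        (f := fun τ => |K (R * Real.sin τ) * (1 - Real.cos τ)|)
        (g := fun τ => (a/R)^2 * (|K (R * Real.sin τ)| * Real.cos τ) + (a/R)^4 * B)
        ((by fun_prop : Continuous fun τ => |K (R * Real.sin τ) * (1 - Real.cos τ)|).intervalIntegrable _ _)
        ((by fun_prop : Continuous fun τ => (a/R)^2 * (|K (R * Real.sin τ)| * Real.cos τ) + (a/R)^4 * B).intervalIntegrable _ _)
        key
      refine hmono.trans ?_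
      rw [intervalIntegral.integral_add
        ((by fun_prop : Continuous fun τ => (a/R)^2 * (|K (R * Real.sin τ)| * Real.cos τ)).intervalIntegrable _ _)
        (by simp), intervalIntegral.integral_const_mul, cv (fun x => |K x|) hc.abs,
        intervalIntegral.integral_const]
      have h3 : ∫ x in (-R)..R, |K x| ≤ I := by
        rw [intervalIntegral.integral_of_le (by linarith)]
        exact setIntegral_le_integral hi.abs (Filter.Eventually.of_forall fun x => abs_nonneg _)
      have h4 : (Real.pi/2 - -(Real.pi/2)) • ((a/R)^4 * B) = (a/R)^4 * B * Real.pi := by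
        rw [smul_eq_mul]; ring
      rw [h4]
      gcongr
    refine e2.trans ?_
    rw [le_div_iff₀ (by positivity)]
    have h5 : (1+R)^3 ≤ 8 * R^3 := by
      calc (1+R)^3 ≤ (2*R)^3 := by gcongr; linarith
        _ = 8 * R^3 := by ring
    have h6 : (a/R)^2 * (R⁻¹ * I) + (a/R)^4 * B * Real.pi ≤ (a^2 * I + a^4 * B * Real.pi) / R^3 := by
      have : (a/R)^4 * B * Real.pi ≤ a^4 * B * Real.pi / R^3 := by
        rw [div_pow, div_mul_eq_mul_div, div_mul_eq_mul_div]
        apply div_le_div_of_nonneg_left (by positivity) (by positivity)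
        exact pow_le_pow_right₀ hR1 (by norm_num)
      have h7 : (a/R)^2 * (R⁻¹ * I) = a^2 * I / R^3 := by field_simp
      rw [h7, add_div]
      gcongr
    calc _ ≤ (a^2 * I + a^4 * B * Real.pi) / R^3 * (8 * R^3) := by gcongr
      _ = 8 * (a^2 * I + a^4 * B * Real.pi) := by field_simp
      _ ≤ _ := by have : 0 ≤ B * Real.pi * (1 + m)^3 := by positivity
                  linarith

/-- projection transversal to direction `θ`. -/
def pr (θ x y : ℝ) : ℝ := -Real.sin θ * x + Real.cos θ * y

lemma kernel_circle (K : ℝ → ℝ) (hc : Continuous K) (hi : Integrable K) (a : ℝ) (ha : 0 < a)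
    (hs : ∀ x, a ≤ |x| → K x = 0) (B : ℝ) (hB : ∀ x, |K x| ≤ B)
    (h0 : ∀ R, a ≤ R → ∫ x in (-R)..R, K x = 0) :
    ∃ C : ℝ, 0 ≤ C ∧ ∀ x y : ℝ,
      ∫ θ in (-Real.pi)..Real.pi, K (pr θ x y) ≤ C / (1 + max |x| |y|)^3 := by
  obtain ⟨C1, hC1, h1⟩ := kernel_halfcircle K hc hi a ha hs B hB h0
  obtain ⟨C2, hC2, h2⟩ := kernel_halfcircle (fun x => K (-x)) (by fun_prop) hi.comp_neg a ha
    (fun x hx => hs _ (by simpa using hx)) B (fun x => hB _) (fun R hR => by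
      rw [intervalIntegral.integral_comp_neg]; simpa using h0 R hR)
  refine ⟨C1 + C2, by positivity, fun x y => ?_⟩
  set z : ℂ := ⟨x, y⟩ with hz
  set R := ‖z‖ with hR
  set φ := Complex.arg z with hφ
  have hx : R * Real.cos φ = x := Complex.norm_mul_cos_arg z
  have hy : R * Real.sin φ = y := Complex.norm_mul_sin_arg z
  have hR0 : 0 ≤ R := norm_nonneg _
  have hp : ∀ θ, K (pr θ x y) = (fun τ => K (-(R * Real.sin τ))) (θ - φ) := by
    intro θ
    simp only [pr, Real.sin_sub]
    congr 1
    rw [← hx, ← hy]; ring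
  have hper : Function.Periodic (fun τ => K (-(R * Real.sin τ))) (2 * Real.pi) := by
    intro τ; simp [Real.sin_add_two_pi]
  have e : ∫ θ in (-Real.pi)..Real.pi, K (pr θ x y)
      = (∫ τ in (-(Real.pi/2))..(Real.pi/2), K (-(R * Real.sin τ))) +
        ∫ τ in (-(Real.pi/2))..(Real.pi/2), K (R * Real.sin τ) := by
    simp_rw [hp]
    rw [intervalIntegral.integral_comp_sub_right (fun τ => K (-(R * Real.sin τ)))]
    have := hper.intervalIntegral_add_eq (-Real.pi - φ) (-(Real.pi/2))
    rw [show -Real.pi - φ + 2 * Real.pi = Real.pi - φ by ring] at this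
    rw [this]
    have hci : ∀ u v, IntervalIntegrable (fun τ => K (-(R * Real.sin τ))) volume u v := fun u v =>
      (by fun_prop : Continuous fun τ => K (-(R * Real.sin τ))).intervalIntegrable _ _
    rw [← intervalIntegral.integral_add_adjacent_intervals (hci _ (Real.pi/2)) (hci _ _)]
    congr 1
    have h3 := intervalIntegral.integral_comp_add_right (a := -(Real.pi/2)) (b := Real.pi/2)
      (fun τ => K (-(R * Real.sin τ))) Real.pi
    simp only [Real.sin_add_pi, mul_neg, neg_neg] at h3
    rw [h3]
    congr 1 <;> ring
  rw [e]
  have a1 := (le_abs_self _).trans (h1 R hR0)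
  have a2 := (le_abs_self _).trans (h2 R hR0)
  have hmax : max |x| |y| ≤ R := max_le (Complex.abs_re_le_norm z) (Complex.abs_im_le_norm z)
  have hm0 : 0 ≤ max |x| |y| := (abs_nonneg x).trans (le_max_left _ _)
  calc _ ≤ C2 / (1+R)^3 + C1 / (1+R)^3 := by simpa using add_le_add a2 a1
    _ = (C1 + C2) / (1+R)^3 := by ring
    _ ≤ _ := by gcongr

/-! The bump functions -/

def phi (x : ℝ) : ℝ := max 0 (min 1 (4 - |x|))

def psi (q x : ℝ) : ℝ := phi x - phi (x / q) / q

def Ker (q v : ℝ) : ℝ := ∫ y, psi q y * psi q (y + v)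

lemma phi_cont : Continuous phi := by unfold phi; fun_prop
lemma phi_nonneg (x : ℝ) : 0 ≤ phi x := le_max_left _ _
lemma phi_le_one (x : ℝ) : phi x ≤ 1 := max_le (by norm_num) (min_le_left _ _)
lemma phi_one {x : ℝ} (h : |x| ≤ 3) : phi x = 1 := by
  unfold phi; rw [min_eq_left (by linarith)]; norm_num
lemma phi_zero {x : ℝ} (h : 4 ≤ |x|) : phi x = 0 := by
  unfold phi; rw [max_eq_left]; exact (min_le_right _ _).trans (by linarith)

lemma psi_cont (q : ℝ) : Continuous (psi q) := by
  unfold psi; have := phi_cont; fun_prop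

lemma psi_zero {q : ℝ} (hq : 1 ≤ q) {x : ℝ} (h : 4 * q ≤ |x|) : psi q x = 0 := by
  unfold psi
  rw [phi_zero (by linarith), phi_zero]
  · simp
  · rw [abs_div, abs_of_pos (by linarith : 0 < q), le_div_iff₀ (by linarith)]; exact h

lemma psi_abs {q : ℝ} (hq : 1 ≤ q) (x : ℝ) : |psi q x| ≤ 1 := by
  unfold psi
  have h1 := phi_nonneg x
  have h2 := phi_le_one x
  have h3 : 0 ≤ phi (x/q) / q := div_nonneg (phi_nonneg _) (by linarith)
  have h4 : phi (x/q) / q ≤ 1 := by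
    rw [div_le_one (by linarith)]; exact (phi_le_one _).trans hq
  rw [abs_le]; constructor <;> linarith

lemma psi_supp {q : ℝ} (hq : 1 ≤ q) : HasCompactSupport (psi q) := by
  apply HasCompactSupport.intro (isCompact_Icc (a := -(4*q)) (b := 4*q))
  intro x hx
  apply psi_zero hq
  by_contra h
  push Not at h
  exact hx ⟨(abs_lt.1 h).1.le, (abs_lt.1 h).2.le⟩

lemma phi_supp : HasCompactSupport phi := by
  apply HasCompactSupport.intro (isCompact_Icc (a := -4) (b := 4))
  intro x hx
  apply phi_zero
  by_contra h
  push Not at h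
  exact hx ⟨(abs_lt.1 h).1.le, (abs_lt.1 h).2.le⟩

lemma psi_int {q : ℝ} (hq : 1 ≤ q) : Integrable (psi q) :=
  (psi_cont q).integrable_of_hasCompactSupport (psi_supp hq)

lemma psi_integral {q : ℝ} (hq : 1 ≤ q) : ∫ x, psi q x = 0 := by
  have hp : Integrable phi := phi_cont.integrable_of_hasCompactSupport phi_supp
  unfold psi
  rw [integral_sub hp ((hp.comp_div (by linarith)).div_const q), integral_div,
    Measure.integral_comp_div (fun x => phi x) q, abs_of_pos (by linarith : 0 < q), smul_eq_mul,
    mul_div_cancel_left₀ _ (by linarith), sub_self]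

lemma Ker_eq {q : ℝ} (hq : 1 ≤ q) (v : ℝ) :
    Ker q v = ∫ y in (-(4*q))..(4*q), psi q y * psi q (y + v) := by
  unfold Ker
  rw [intervalIntegral.integral_of_le (by linarith), ← setIntegral_univ]
  refine (setIntegral_eq_of_subset_of_forall_sdiff_eq_zero MeasurableSet.univ (subset_univ _) ?_)
  intro x hx
  rw [psi_zero hq, zero_mul]
  by_contra h
  push Not at h
  exact hx.2 ⟨(abs_lt.1 h).1, (abs_lt.1 h).2.le⟩

lemma Ker_cont {q : ℝ} (hq : 1 ≤ q) : Continuous (Ker q) := by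
  have := psi_cont q
  rw [show Ker q = fun v => _ from funext (Ker_eq hq)]
  exact intervalIntegral.continuous_parametric_intervalIntegral_of_continuous' (by fun_prop) _ _

lemma Ker_zero {q : ℝ} (hq : 1 ≤ q) {v : ℝ} (h : 8 * q ≤ |v|) : Ker q v = 0 := by
  unfold Ker
  rw [show (fun y => psi q y * psi q (y + v)) = fun _ => 0 from ?_]
  · simp
  · ext y
    by_cases hy : 4 * q ≤ |y|
    · rw [psi_zero hq hy, zero_mul]
    · rw [psi_zero hq (x := y + v), mul_zero]
      push Not at hy
      have := abs_sub_abs_le_abs_sub v (-y)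
      rw [abs_neg, sub_neg_eq_add, add_comm v y] at this
      linarith

lemma Ker_abs {q : ℝ} (hq : 1 ≤ q) (v : ℝ) : |Ker q v| ≤ 8 * q := by
  rw [Ker_eq hq]
  have := intervalIntegral.norm_integral_le_of_norm_le_const (a := -(4*q)) (b := 4*q)
        (f := fun y => psi q y * psi q (y + v)) (C := 1) (fun x _ => by
          rw [norm_mul, Real.norm_eq_abs, Real.norm_eq_abs]
          exact mul_le_one₀ (psi_abs hq _) (abs_nonneg _) (psi_abs hq _))
  rw [Real.norm_eq_abs] at this
  refine this.trans (le_of_eq ?_)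
  rw [one_mul, abs_of_nonneg (by linarith)]; ring

lemma Ker_integrable {q : ℝ} (hq : 1 ≤ q) : Integrable (Ker q) := by
  apply (Ker_cont hq).integrable_of_hasCompactSupport
  apply HasCompactSupport.intro (isCompact_Icc (a := -(8*q)) (b := 8*q))
  intro x hx
  apply Ker_zero hq
  by_contra h
  push Not at h
  exact hx ⟨(abs_lt.1 h).1.le, (abs_lt.1 h).2.le⟩

lemma Ker_mean {q : ℝ} (hq : 1 ≤ q) (R : ℝ) (hR : 8 * q ≤ R) : ∫ x in (-R)..R, Ker q x = 0 := by
  simp_rw [Ker_eq hq]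
  have hc := psi_cont q
  have hsw : ∫ x in (-R)..R, ∫ y in (-(4*q))..(4*q), psi q y * psi q (y + x) =
      ∫ y in (-(4*q))..(4*q), ∫ x in (-R)..R, psi q y * psi q (y + x) := by
    apply intervalIntegral_intervalIntegral_swap
    have hK : IsCompact (uIcc (-R) R ×ˢ uIcc (-(4*q)) (4*q)) := isCompact_uIcc.prod isCompact_uIcc
    exact ((by fun_prop : Continuous (Function.uncurry fun x y => psi q y * psi q (y + x))).continuousOn.integrableOn_compact
      hK).mono_set (prod_mono uIoc_subset_uIcc uIoc_subset_uIcc)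
  rw [hsw]
  rw [intervalIntegral.integral_congr (g := fun _ => 0)]
  · simp
  · intro y hy
    rw [uIcc_of_le (by linarith)] at hy
    simp only
    rw [intervalIntegral.integral_const_mul, intervalIntegral.integral_comp_add_left (fun x => psi q x)]
    have : ∫ x in (y + -R)..(y+R), psi q x = ∫ x, psi q x := by
      rw [intervalIntegral.integral_of_le (by linarith), ← setIntegral_univ (μ := volume) (f := psi q)]
      refine (setIntegral_eq_of_subset_of_forall_sdiff_eq_zero MeasurableSet.univ (subset_univ _) ?_).symm
      intro x hx
      apply psi_zero hq
      by_contra h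
      push Not at h
      exact hx.2 ⟨by linarith [(abs_lt.1 h).1, hy.2], by linarith [(abs_lt.1 h).2, hy.1]⟩
    rw [this, psi_integral hq, mul_zero]

lemma Ker_circle {q : ℝ} (hq : 1 ≤ q) : ∃ C : ℝ, 0 ≤ C ∧ ∀ x y : ℝ,
      ∫ θ in (-Real.pi)..Real.pi, Ker q (pr θ x y) ≤ C / (1 + max |x| |y|)^3 :=
  kernel_circle _ (Ker_cont hq) (Ker_integrable hq) (8*q) (by linarith) (fun _ h => Ker_zero hq h)
    (8*q) (Ker_abs hq) (Ker_mean hq)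

lemma psi_prod_int {q : ℝ} (hq : 1 ≤ q) (u v : ℝ) :
    Integrable (fun y => psi q (y - u) * psi q (y - v)) := by
  have hc := psi_cont q
  apply (by fun_prop : Continuous (fun y => psi q (y - u) * psi q (y - v))).integrable_of_hasCompactSupport
  apply HasCompactSupport.mul_right
  exact (psi_supp hq).comp_homeomorph (Homeomorph.subRight u)

lemma sq_integral {ι : Type*} (F : Finset ι) (x : ι → ℝ) {q : ℝ} (hq : 1 ≤ q) :
    Integrable (fun y => (∑ a ∈ F, psi q (y - x a))^2) ∧
    ∫ y, (∑ a ∈ F, psi q (y - x a))^2 = ∑ a ∈ F, ∑ a' ∈ F, Ker q (x a - x a') := by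
  have e : (fun y => (∑ a ∈ F, psi q (y - x a))^2) =
      fun y => ∑ a ∈ F, ∑ a' ∈ F, psi q (y - x a) * psi q (y - x a') := by
    ext y; rw [sq, Finset.sum_mul_sum]
  rw [e]
  constructor
  · exact integrable_finsetSum _ fun a _ => integrable_finsetSum _ fun a' _ => psi_prod_int hq _ _
  · rw [integral_finsetSum _ fun a _ => integrable_finsetSum _ fun a' _ => psi_prod_int hq _ _]
    refine Finset.sum_congr rfl fun a _ => ?_
    rw [integral_finsetSum _ fun a' _ => psi_prod_int hq _ _]
    refine Finset.sum_congr rfl fun a' _ => ?_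
    unfold Ker
    rw [← integral_sub_right_eq_self (fun y => psi q y * psi q (y + (x a - x a'))) (x a)]
    congr 1
    ext y
    congr 2
    ring

end Heavy



namespace Heavy

def par (b j : ℕ) (a : ℤ × ℤ) : ℤ × ℤ := (a.1 / (b:ℤ)^j, a.2 / (b:ℤ)^j)

lemma par_par (b i j : ℕ) (a : ℤ × ℤ) : par b i (par b j a) = par b (j + i) a := by
  unfold par
  simp only [pow_add]
  rw [Int.ediv_ediv_of_nonneg (by positivity), Int.ediv_ediv_of_nonneg (by positivity)]

def idx (b k : ℕ) (z : Plane) : ℤ × ℤ := (⌊z 0 * (b:ℝ)^k⌋, ⌊z 1 * (b:ℝ)^k⌋)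

lemma par_idx {b : ℕ} (hb : 1 ≤ b) (z : Plane) (i k : ℕ) (h : i ≤ k) :
    par b (k - i) (idx b k z) = idx b i z := by
  have key : ∀ x : ℝ, ⌊x * (b:ℝ)^k⌋ / (b:ℤ)^(k-i) = ⌊x * (b:ℝ)^i⌋ := by
    intro x
    have := Int.floor_div_natCast (x * (b:ℝ)^k) (b^(k-i))
    push_cast at this
    rw [← this]
    congr 1
    have hb' : (b:ℝ) ≠ 0 := by positivity
    rw [show (b:ℝ)^k = b^i * b^(k-i) by rw [← pow_add]; congr 1; omega]
    field_simp
  unfold par idx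
  simp only [key]

lemma select {ι : Type*} (b : ℕ) (β : ℝ) (hβ : 1 < β) (K : ι → ℕ) (a : ι → ℤ × ℤ)
    (n : ℕ) (htot : ∑' m, (ENNReal.ofReal β⁻¹)^(K m) < (ENNReal.ofReal β⁻¹)^n) :
    ∃ P : ℕ → Finset (ℤ × ℤ), (∀ k ≤ n, P k = ∅) ∧ (∀ k, ((P k).card : ℝ) ≤ β^k) ∧
      (∀ k i, i ≤ k → ∀ a', (((P k).filter (fun x => par b (k-i) x = a')).card : ℝ) ≤ β^(k-i)) ∧
      ∀ m (c : ℕ → ℤ × ℤ), (∀ i k, i ≤ k → par b (k-i) (c k) = c i) → c (K m) = a m →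
        ∃ k, c k ∈ P k := by
  classical
  set w := ENNReal.ofReal β⁻¹ with hw
  have hβ0 : 0 < β := by linarith
  have hw0 : w ≠ 0 := by simp [hw, hβ0]
  have hwt : w ≠ ∞ := by simp [hw]
  have hw1 : w ≤ 1 := by
    rw [hw]; apply ENNReal.ofReal_le_one.2; exact inv_le_one_of_one_le₀ hβ.le
  set W : ℕ → ℤ × ℤ → ℝ≥0∞ := fun i a' =>
    ∑' m, if i ≤ K m ∧ par b (K m - i) (a m) = a' then w^(K m) else 0 with hW
  have hWT : ∀ i a', W i a' ≤ ∑' m, w^(K m) := by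
    intro i a'
    apply ENNReal.tsum_le_tsum
    intro m; split_ifs <;> simp
  have hsum : ∀ (k i : ℕ) (a' : ℤ × ℤ) (F : Finset (ℤ × ℤ)), i ≤ k → (∀ x ∈ F, w^k ≤ W k x) →
      (∀ x ∈ F, par b (k - i) x = a') → (F.card : ℝ≥0∞) * w^k ≤ W i a' := by
    intro k i a' F hik hF hp
    calc (F.card : ℝ≥0∞) * w^k = ∑ x ∈ F, w^k := by simp
      _ ≤ ∑ x ∈ F, W k x := Finset.sum_le_sum hF
      _ = ∑' m, ∑ x ∈ F, (if k ≤ K m ∧ par b (K m - k) (a m) = x then w^(K m) else 0) := by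
          rw [Summable.tsum_finsetSum]; intro _ _; exact ENNReal.summable
      _ ≤ W i a' := by
          apply ENNReal.tsum_le_tsum
          intro m
          by_cases h : k ≤ K m ∧ par b (K m - k) (a m) ∈ F
          · rw [Finset.sum_eq_single_of_mem _ h.2, if_pos ⟨h.1, rfl⟩, if_pos]
            · refine ⟨hik.trans h.1, ?_⟩
              rw [← hp _ h.2, par_par]
              congr 1
              omega
            · intro x _ hx
              rw [if_neg]; rintro ⟨_, h2⟩; exact hx h2.symm
          · rw [Finset.sum_eq_zero]
            · exact zero_le
            · intro x hx
              rw [if_neg]; rintro ⟨h1, h2⟩; exact h ⟨h1, h2 ▸ hx⟩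
  have hsum' : ∀ (k : ℕ) (F : Finset (ℤ × ℤ)), (∀ x ∈ F, w^k ≤ W k x) →
       (F.card : ℝ≥0∞) * w^k ≤ 1 := by
    intro k F hF
    refine le_trans ?_ (htot.le.trans (pow_le_one₀ zero_le hw1))
    calc (F.card : ℝ≥0∞) * w^k = ∑ x ∈ F, w^k := by simp
      _ ≤ ∑ x ∈ F, W k x := Finset.sum_le_sum hF
      _ = ∑' m, ∑ x ∈ F, (if k ≤ K m ∧ par b (K m - k) (a m) = x then w^(K m) else 0) := by
          rw [Summable.tsum_finsetSum]; intro _ _; exact ENNReal.summable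
      _ ≤ _ := by
          apply ENNReal.tsum_le_tsum
          intro m
          by_cases h : k ≤ K m ∧ par b (K m - k) (a m) ∈ F
          · rw [Finset.sum_eq_single_of_mem _ h.2, if_pos ⟨h.1, rfl⟩]
            intro x _ hx
            rw [if_neg]; rintro ⟨_, h2⟩; exact hx h2.symm
          · rw [Finset.sum_eq_zero]
            · exact zero_le
            · intro x hx
              rw [if_neg]; rintro ⟨h1, h2⟩; exact h ⟨h1, h2 ▸ hx⟩
  have conv : ∀ (N k i : ℕ), i ≤ k → (N : ℝ≥0∞) * w^k ≤ w^i → (N:ℝ) ≤ β^(k-i) := by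
    intro N k i hik h
    have h1 := ENNReal.toReal_mono (ENNReal.pow_ne_top hwt) h
    rw [ENNReal.toReal_mul, ENNReal.toReal_pow, ENNReal.toReal_pow, hw,
      ENNReal.toReal_ofReal (by positivity), ENNReal.toReal_natCast, inv_pow, inv_pow] at h1
    rw [show β^k = β^(k-i) * β^i by rw [← pow_add]; congr 1; omega] at h1
    have : (N:ℝ) = N * (β^(k-i) * β^i)⁻¹ * (β^(k-i) * β^i) := by field_simp
    rw [this]
    calc _ ≤ (β^i)⁻¹ * (β^(k-i) * β^i) := by gcongr
      _ = _ := by field_simp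
  let S : ℕ → Set (ℤ × ℤ) := fun k => {x | w^k ≤ W k x ∧ ∀ i < k, ¬ (w^i ≤ W i (par b (k-i) x))}
  have hfin : ∀ k, (S k).Finite := by
    intro k
    by_contra hinf
    obtain ⟨N, hN⟩ := exists_nat_gt (β^k)
    obtain ⟨F, hFS, hFc⟩ := Set.Infinite.exists_subset_card_eq hinf N
    have := hsum' k F (fun x hx => (hFS hx).1)
    have := conv F.card k 0 (Nat.zero_le _) (by simpa using this)
    rw [hFc] at this
    simp at this
    linarith
  refine ⟨fun k => (hfin k).toFinset, ?_, ?_, ?_, ?_⟩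
  · intro k hk
    rw [Set.Finite.toFinset_eq_empty, Set.eq_empty_iff_forall_notMem]
    rintro x ⟨hx, -⟩
    have := hx.trans (hWT k x)
    exact absurd (this.trans_lt htot) (not_lt.2 (pow_le_pow_of_le_one zero_le hw1 hk))
  · intro k
    have := hsum' k (hfin k).toFinset (fun x hx => ((hfin k).mem_toFinset.1 hx).1)
    simpa using conv _ k 0 (Nat.zero_le _) (by simpa using this)
  · intro k i hik a'
    apply conv _ k i hik
    set F := (hfin k).toFinset.filter (fun x => par b (k-i) x = a') with hFd
    have hF : ∀ x ∈ F, x ∈ S k ∧ par b (k-i) x = a' := by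
      intro x hx
      simpa [hFd] using hx
    rcases hik.eq_or_lt with rfl | hlt
    · have : F.card ≤ 1 := by
        rw [Finset.card_le_one]
        intro x hx y hy
        have h1 := (hF x hx).2
        have h2 := (hF y hy).2
        simp [par] at h1 h2
        exact h1.trans h2.symm
      calc _ ≤ ((1:ℕ) : ℝ≥0∞) * w^i := by gcongr
        _ = _ := by simp
    · rcases F.eq_empty_or_nonempty with h | ⟨x, hx⟩
      · simp [h]
      · have h1 := (hF x hx).1.2 i hlt
        rw [(hF x hx).2] at h1
        exact (hsum k i a' F hik (fun x hx => (hF x hx).1.1) (fun x hx => (hF x hx).2)).trans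
          (not_le.1 h1).le
  · intro m c hc hm
    have hex : ∃ k, w^k ≤ W k (c k) := by
      refine ⟨K m, ?_⟩
      have := ENNReal.le_tsum (f := fun m' => if K m ≤ K m' ∧ par b (K m' - K m) (a m') = c (K m) then w^(K m') else 0) m
      rw [if_pos] at this
      · exact this
      · refine ⟨le_rfl, ?_⟩
        rw [hm]; simp [par]
    refine ⟨Nat.find hex, ?_⟩
    rw [Set.Finite.mem_toFinset]
    refine ⟨Nat.find_spec hex, fun i hi => ?_⟩
    rw [hc _ _ hi.le]
    exact Nat.find_min hex hi

end Heavy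


namespace Heavy

lemma exists_level {b : ℕ} (hb : 2 ≤ b) {s : ℝ} (hs : 0 < s) (d e : ℝ≥0∞) (hd : d ≤ 1) (he : e ≠ 0) :
    ∃ k : ℕ, d ≤ ENNReal.ofReal (((b:ℝ)⁻¹)^k) ∧
      (ENNReal.ofReal (((b:ℝ)^s)⁻¹))^k ≤ ENNReal.ofReal ((b:ℝ)^s) * d^s + e := by
  have hb1 : (1:ℝ) < b := by exact_mod_cast hb
  have hb0 : (0:ℝ) < b := by linarith
  have hβ : 1 < (b:ℝ)^s := Real.one_lt_rpow hb1 hs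
  have hβ0 : 0 < (b:ℝ)^s := by linarith
  rcases eq_or_ne d 0 with rfl | hd0
  · have hw : ENNReal.ofReal (((b:ℝ)^s)⁻¹) < 1 := by
      rw [ENNReal.ofReal_lt_one]; exact inv_lt_one_of_one_lt₀ hβ
    have := ENNReal.tendsto_pow_atTop_nhds_zero_of_lt_one hw
    obtain ⟨k, hk⟩ := (this.eventually (gt_mem_nhds (pos_iff_ne_zero.2 he))).exists
    exact ⟨k, zero_le, hk.le.trans le_add_self⟩
  · have hdt : d ≠ ∞ := ne_top_of_le_ne_top ENNReal.one_ne_top hd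
    set x := d.toReal with hx
    have hx0 : 0 < x := ENNReal.toReal_pos hd0 hdt
    have hx1 : x ≤ 1 := by
      have := ENNReal.toReal_mono ENNReal.one_ne_top hd
      simpa using this
    obtain ⟨k, hk1, hk2⟩ := exists_nat_pow_near_of_lt_one hx0 hx1 (inv_pos.2 hb0) (inv_lt_one_of_one_lt₀ hb1)
    have hdx : d = ENNReal.ofReal x := (ENNReal.ofReal_toReal hdt).symm
    refine ⟨k, ?_, ?_⟩
    · rw [hdx]; exact ENNReal.ofReal_le_ofReal hk2
    · refine le_trans ?_ le_self_add
      rw [hdx, ENNReal.ofReal_rpow_of_pos hx0, ← ENNReal.ofReal_mul hβ0.le, ← ENNReal.ofReal_pow (by positivity)]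
      apply ENNReal.ofReal_le_ofReal
      have h1 : (((b:ℝ)⁻¹)^(k+1))^s ≤ x^s := Real.rpow_le_rpow (by positivity) hk1.le hs.le
      have h2 : (((b:ℝ)⁻¹)^(k+1))^s = (((b:ℝ)^s)⁻¹)^(k+1) := by
        rw [← Real.inv_rpow hb0.le, ← Real.rpow_natCast, ← Real.rpow_natCast, ← Real.rpow_mul (by positivity),
          ← Real.rpow_mul (by positivity), mul_comm]
      rw [h2] at h1
      calc (((b:ℝ)^s)⁻¹)^k = (b:ℝ)^s * (((b:ℝ)^s)⁻¹)^(k+1) := by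
            rw [pow_succ]; field_simp
        _ ≤ _ := by gcongr

lemma coord_le (x z : Plane) (i : Fin 2) : |x i - z i| ≤ dist x z := by
  rw [dist_eq_norm]
  have := PiLp.norm_apply_le (x - z) i
  simpa using this

lemma floor_near {u v : ℝ} (h : |u - v| ≤ 1) : ∃ o : Fin 3, ⌊u⌋ = ⌊v⌋ + (o : ℕ) - 1 := by
  have h1 := abs_le.1 h
  have a1 : ⌊v⌋ - 1 ≤ ⌊u⌋ := by
    have : ⌊v - 1⌋ ≤ ⌊u⌋ := Int.floor_le_floor (by linarith)
    simpa using this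
  have a2 : ⌊u⌋ ≤ ⌊v⌋ + 1 := by
    have : ⌊u⌋ ≤ ⌊v + 1⌋ := Int.floor_le_floor (by linarith)
    simpa using this
  obtain h | h | h : ⌊u⌋ = ⌊v⌋ - 1 ∨ ⌊u⌋ = ⌊v⌋ ∨ ⌊u⌋ = ⌊v⌋ + 1 := by omega
  · exact ⟨0, by simp [h]⟩
  · exact ⟨1, by simp [h]⟩
  · exact ⟨2, by simp [h]; ring⟩

lemma cover (A : Set Plane) {s : ℝ} (hs : 0 < s) (hA : μH[s] A = 0) {b : ℕ} (hb : 2 ≤ b) (n : ℕ) :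
    ∃ P : ℕ → Finset (ℤ × ℤ), (∀ k ≤ n, P k = ∅) ∧ (∀ k, ((P k).card : ℝ) ≤ ((b:ℝ)^s)^k) ∧
      (∀ k i, i ≤ k → ∀ a', (((P k).filter (fun x => par b (k-i) x = a')).card : ℝ) ≤ ((b:ℝ)^s)^(k-i)) ∧
      ∀ z ∈ A, ∃ k, idx b k z ∈ P k := by
  have hb1 : (1:ℝ) < b := by exact_mod_cast hb
  have hb0 : (0:ℝ) < b := by linarith
  set β := (b:ℝ)^s with hβd
  have hβ : 1 < β := Real.one_lt_rpow hb1 hs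
  set w := ENNReal.ofReal β⁻¹ with hw
  have hw0 : w ≠ 0 := by simp [hw]; linarith
  set ε := w^n with hε
  have hε0 : ε ≠ 0 := pow_ne_zero _ hw0
  set B := ENNReal.ofReal β with hB
  have hB0 : B ≠ 0 := by simp [hB]; linarith
  set ε' := ε / 18 / B with hε'
  have hε'0 : 0 < ε' := ENNReal.div_pos (ENNReal.div_pos hε0 (by simp)).ne' (by simp [hB])
  rw [Measure.hausdorffMeasure_apply] at hA
  have h1 : ⨅ (t : ℕ → Set Plane) (_ : A ⊆ ⋃ n, t n) (_ : ∀ n, ediam (t n) ≤ 1),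
          ∑' n, ⨆ _ : (t n).Nonempty, ediam (t n) ^ s < ε' := by
    refine lt_of_le_of_lt ?_ hε'0
    rw [← hA]
    exact le_iSup₂ (f := fun (r : ℝ≥0∞) (_ : 0 < r) => ⨅ (t : ℕ → Set Plane) (_ : A ⊆ ⋃ n, t n) (_ : ∀ n, ediam (t n) ≤ r),
          ∑' n, ⨆ _ : (t n).Nonempty, ediam (t n) ^ s) 1 one_pos
  simp only [iInf_lt_iff] at h1
  obtain ⟨t, htA, htd, hts⟩ := h1
  obtain ⟨e, he0, hes⟩ := ENNReal.exists_pos_sum_of_countable' (ENNReal.div_pos hε0 (by simp : (18:ℝ≥0∞) ≠ ∞)).ne' ℕ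
  have h2 : ∀ m, ∃ (k : ℕ) (z : Plane), (∀ x ∈ t m, dist x z ≤ ((b:ℝ)⁻¹)^k) ∧
      w^k ≤ B * (⨆ _ : (t m).Nonempty, ediam (t m) ^ s) + e m := by
    intro m
    rcases (t m).eq_empty_or_nonempty with hem | ⟨z, hz⟩
    · obtain ⟨k, -, hk⟩ := exists_level hb hs 0 (e m) zero_le (he0 m).ne'
      refine ⟨k, 0, by simp [hem], ?_⟩
      rw [ENNReal.zero_rpow_of_pos hs, mul_zero, zero_add] at hk
      exact hk.trans le_add_self
    · obtain ⟨k, hk1, hk⟩ := exists_level hb hs (ediam (t m)) (e m) (htd m) (he0 m).ne'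
      refine ⟨k, z, ?_, ?_⟩
      · intro x hx
        have := (Metric.edist_le_ediam_of_mem hx hz).trans hk1
        rw [edist_dist] at this
        exact (ENNReal.ofReal_le_ofReal_iff (by positivity)).1 this
      · rw [ciSup_pos ⟨z, hz⟩]; exact hk
  choose K z hz hK using h2
  obtain ⟨P, hP1, hP2, hP3, hP4⟩ := select (ι := ℕ × (Fin 3 × Fin 3)) b β hβ (fun p => K p.1)
    (fun p => ((idx b (K p.1) (z p.1)).1 + (p.2.1 : ℕ) - 1, (idx b (K p.1) (z p.1)).2 + (p.2.2 : ℕ) - 1)) n (by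
      rw [ENNReal.tsum_prod']
      simp only [tsum_fintype, Finset.sum_const, Finset.card_univ, Fintype.card_prod, Fintype.card_fin]
      simp only [nsmul_eq_mul]
      rw [ENNReal.tsum_mul_left]
      have h3 : ∑' m, w^(K m) < ε/9 := by
        calc ∑' m, w^(K m) ≤ ∑' m, (B * (⨆ _ : (t m).Nonempty, ediam (t m) ^ s) + e m) :=
              ENNReal.tsum_le_tsum hK
          _ = B * (∑' m, (⨆ _ : (t m).Nonempty, ediam (t m) ^ s)) + ∑' m, e m := by
              rw [ENNReal.tsum_add, ENNReal.tsum_mul_left]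
          _ < B * ε' + ε/18 := by
              apply ENNReal.add_lt_add_of_le_of_lt _ _ hes
              · refine ENNReal.mul_ne_top (by simp [hB]) hts.ne_top
              · gcongr
          _ = ε/18 + ε/18 := by
              rw [hε', ENNReal.mul_div_cancel hB0 (by simp [hB])]
          _ = ε/9 := by
              rw [ENNReal.div_add_div_same, ← two_mul, show (18:ℝ≥0∞) = 2 * 9 by norm_num]
              exact ENNReal.mul_div_mul_left _ _ (by simp) (by simp)
      calc _ < ((3*3:ℕ):ℝ≥0∞) * (ε/9) := by
              rw [ENNReal.mul_lt_mul_iff_right (by simp) (by simp)]; exact h3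
        _ = ε := by
              norm_num
              exact ENNReal.mul_div_cancel (by simp) (by simp))
  refine ⟨P, hP1, hP2, hP3, fun x hx => ?_⟩
  obtain ⟨m, hm⟩ := mem_iUnion.1 (htA hx)
  have hd := hz m x hm
  have hc : ∀ i : Fin 2, ∃ o : Fin 3, ⌊x i * (b:ℝ)^(K m)⌋ = ⌊z m i * (b:ℝ)^(K m)⌋ + (o:ℕ) - 1 := by
    intro i
    apply floor_near
    rw [← sub_mul, abs_mul, abs_of_pos (pow_pos hb0 _)]
    have := (coord_le x (z m) i).trans hd
    rw [inv_pow, ← one_div, le_div_iff₀ (pow_pos hb0 _)] at this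
    exact this
  obtain ⟨o0, h0⟩ := hc 0
  obtain ⟨o1, h1⟩ := hc 1
  exact hP4 (m, (o0, o1)) (fun k => idx b k x) (fun i k h => par_idx (by omega) x i k h)
    (Prod.ext h0 h1)

end Heavy


namespace Heavy

lemma ediv_near {b m : ℕ} (hb : 1 ≤ b) {x y : ℤ} (h : |(x:ℝ) - y| ≤ (b:ℝ)^m) :
    ∃ o : Fin 3, y / (b:ℤ)^m = x / (b:ℤ)^m + (o:ℕ) - 1 := by
  have hf : ∀ x : ℤ, ⌊(x:ℝ) / (b:ℝ)^m⌋ = x / (b:ℤ)^m := by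
    intro x
    have := Int.floor_div_natCast (x:ℝ) (b^m)
    push_cast at this
    rw [this, Int.floor_intCast]
  have hb0 : (0:ℝ) < (b:ℝ)^m := by positivity
  rw [← hf, ← hf]
  apply floor_near
  rw [← sub_div, abs_div, abs_of_pos hb0, div_le_one hb0, abs_sub_comm]
  exact h

/-- sup distance, rescaled -/
def Mx (b k i : ℕ) (a a' : ℤ × ℤ) : ℝ :=
  max |((a.1:ℝ) - a'.1) * (b:ℝ)^i / (b:ℝ)^k| |((a.2:ℝ) - a'.2) * (b:ℝ)^i / (b:ℝ)^k|

lemma Mx_nonneg (b k i : ℕ) (a a' : ℤ × ℤ) : 0 ≤ Mx b k i a a' :=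
  (abs_nonneg _).trans (le_max_left _ _)

lemma shell_count {b : ℕ} (hb : 1 ≤ b) {β : ℝ} (P : Finset (ℤ × ℤ)) (k i j : ℕ) (hik : i ≤ k)
    (hji : j ≤ i)
    (hKT : ∀ i, i ≤ k → ∀ a', ((P.filter (fun x => par b (k-i) x = a')).card : ℝ) ≤ β^(k-i))
    (a : ℤ × ℤ) :
    ((P.filter (fun a' => Mx b k i a a' ≤ (b:ℝ)^j)).card : ℝ) ≤ 9 * β^(k-i+j) := by
  classical
  have hm : k - (i - j) = k - i + j := by omega
  have hsub : P.filter (fun a' => Mx b k i a a' ≤ (b:ℝ)^j) ⊆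
      (Finset.univ : Finset (Fin 3 × Fin 3)).biUnion (fun o => P.filter (fun x =>
        par b (k-(i-j)) x = (a.1 / (b:ℤ)^(k-i+j) + (o.1:ℕ) - 1, a.2 / (b:ℤ)^(k-i+j) + (o.2:ℕ) - 1))) := by
    intro a' ha'
    rw [Finset.mem_filter] at ha'
    obtain ⟨haP, hM⟩ := ha'
    have hb0 : (0:ℝ) < b := by exact_mod_cast hb
    have aux : ∀ d : ℝ, |d * (b:ℝ)^i / (b:ℝ)^k| ≤ (b:ℝ)^j → |d| ≤ (b:ℝ)^(k-i+j) := by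
      intro d hd
      rw [abs_div, abs_mul, abs_of_pos (pow_pos hb0 i), abs_of_pos (pow_pos hb0 k),
        div_le_iff₀ (pow_pos hb0 k)] at hd
      have : (b:ℝ)^j * b^k = b^(k-i+j) * b^i := by
        rw [← pow_add, ← pow_add]; congr 1; omega
      rw [this] at hd
      exact le_of_mul_le_mul_right hd (pow_pos hb0 i)
    obtain ⟨o1, h1⟩ := ediv_near hb (aux _ ((le_max_left _ _).trans hM))
    obtain ⟨o2, h2⟩ := ediv_near hb (aux _ ((le_max_right _ _).trans hM))
    rw [Finset.mem_biUnion]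
    refine ⟨(o1, o2), Finset.mem_univ _, ?_⟩
    rw [Finset.mem_filter]
    refine ⟨haP, ?_⟩
    rw [hm]
    exact Prod.ext h1 h2
  have h1 := (Finset.card_le_card hsub).trans Finset.card_biUnion_le
  calc _ ≤ ((∑ o : Fin 3 × Fin 3, (P.filter (fun x =>
        par b (k-(i-j)) x = (a.1 / (b:ℤ)^(k-i+j) + (o.1:ℕ) - 1, a.2 / (b:ℤ)^(k-i+j) + (o.2:ℕ) - 1))).card : ℕ) : ℝ) := by
          exact_mod_cast h1
    _ ≤ ∑ o : Fin 3 × Fin 3, β^(k-(i-j)) := by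
          push_cast
          exact Finset.sum_le_sum fun o _ => hKT (i-j) (by omega) _
    _ = _ := by rw [hm]; simp

lemma shell_bound {B : ℝ} (hB : 1 < B) (i : ℕ) {x : ℝ} (hx : 0 ≤ x) :
    1 / (1 + x)^3 ≤ (∑ j ∈ Finset.range (i+1), if x ≤ B^j then B^3 / (B^3)^j else 0) + 1 / (B^3)^i := by
  classical
  have hB0 : 0 < B := by linarith
  have hn : ∀ j ∈ Finset.range (i+1), (0:ℝ) ≤ if x ≤ B^j then B^3 / (B^3)^j else 0 := by
    intro j _; split_ifs <;> positivity
  by_cases h : x ≤ B^i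
  · have hex : ∃ j, x ≤ B^j := ⟨i, h⟩
    have hj := Nat.find_spec hex
    have hji : Nat.find hex ≤ i := Nat.find_min' hex h
    have hlt := fun m => Nat.find_min hex (m := m)
    generalize Nat.find hex = j at hj hji hlt
    have h1 : 1 / (1 + x)^3 ≤ B^3 / (B^3)^j := by
      rcases j with _ | j
      · simp only [pow_zero, div_one]
        rw [div_le_iff₀ (by positivity)]
        have : (1:ℝ) ≤ B^3 := one_le_pow₀ hB.le
        have : (1:ℝ) ≤ (1+x)^3 := one_le_pow₀ (by linarith)
        nlinarith
      · have := hlt j (Nat.lt_succ_self j)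
        push Not at this
        have e1 : B^3 / (B^3)^(j+1) = 1 / (B^3)^j := by
          rw [pow_succ (B^3) j]; field_simp
        rw [e1]
        apply one_div_le_one_div_of_le (by positivity)
        rw [← pow_mul, mul_comm 3 j, pow_mul]
        gcongr; linarith
    calc _ ≤ B^3 / (B^3)^j := h1
      _ = if x ≤ B^j then B^3 / (B^3)^j else 0 := by rw [if_pos hj]
      _ ≤ _ := Finset.single_le_sum hn (Finset.mem_range.2 (by omega))
      _ ≤ _ := by linarith [show 0 ≤ 1 / (B^3)^i by positivity]
  · push Not at h
    have : 1 / (1+x)^3 ≤ 1 / (B^3)^i := by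
      apply one_div_le_one_div_of_le (by positivity)
      rw [← pow_mul, mul_comm 3 i, pow_mul]
      gcongr; linarith
    linarith [Finset.sum_nonneg hn]

lemma shell_sum {b : ℕ} (hb : 2 ≤ b) {β : ℝ} (hβ : 1 ≤ β) (hβ3 : β < (b:ℝ)^3) :
    ∃ C : ℝ, 0 ≤ C ∧ ∀ (P : Finset (ℤ × ℤ)) (k i : ℕ), i ≤ k → ((P.card : ℝ) ≤ β^k) →
    (∀ i, i ≤ k → ∀ a', ((P.filter (fun x => par b (k-i) x = a')).card : ℝ) ≤ β^(k-i)) →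
    ∀ a, ∑ a' ∈ P, 1 / (1 + Mx b k i a a')^3 ≤ C * β^(k-i) := by
  classical
  have hB : (1:ℝ) < b := by exact_mod_cast hb
  have hB0 : (0:ℝ) < b := by linarith
  set B := (b:ℝ)
  set r := β / B^3 with hr
  have hβ0 : 0 < β := by linarith
  have hr0 : 0 ≤ r := by positivity
  have hr1 : r < 1 := by rw [hr, div_lt_one (by positivity)]; exact hβ3
  have hr1' : 0 < 1 - r := by linarith
  refine ⟨9 * B^3 * (1-r)⁻¹ + 1, by positivity, ?_⟩
  intro P k i hik hP hKT a
  calc ∑ a' ∈ P, 1 / (1 + Mx b k i a a')^3 ≤ ∑ a' ∈ P, ((∑ j ∈ Finset.range (i+1),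
          if Mx b k i a a' ≤ B^j then B^3 / (B^3)^j else 0) + 1 / (B^3)^i) :=
        Finset.sum_le_sum fun a' _ => shell_bound hB i (Mx_nonneg _ _ _ _ _)
    _ = (∑ j ∈ Finset.range (i+1), ((P.filter (fun a' => Mx b k i a a' ≤ B^j)).card : ℝ) * (B^3 / (B^3)^j))
          + P.card * (1 / (B^3)^i) := by
        rw [Finset.sum_add_distrib, Finset.sum_comm]
        congr 1
        · refine Finset.sum_congr rfl fun j _ => ?_
          rw [← Finset.sum_filter]; simp
        · simp
    _ ≤ (∑ j ∈ Finset.range (i+1), (9 * β^(k-i+j)) * (B^3 / (B^3)^j)) + β^k * (1 / (B^3)^i) := by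
        gcongr with j hj
        exact shell_count (by omega) P k i j hik (by simpa [Nat.lt_succ_iff] using hj) hKT a
    _ = 9 * B^3 * β^(k-i) * (∑ j ∈ Finset.range (i+1), r^j) + β^(k-i) * r^i := by
        rw [Finset.mul_sum]
        congr 1
        · refine Finset.sum_congr rfl fun j _ => ?_
          rw [hr, div_pow, pow_add]; ring
        · rw [hr, div_pow, show β^k = β^(k-i) * β^i by rw [← pow_add]; congr 1; omega]; ring
    _ ≤ 9 * B^3 * β^(k-i) * (1-r)⁻¹ + β^(k-i) * 1 := by
        gcongr
        · rw [← tsum_geometric_of_lt_one hr0 hr1]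
          exact (summable_geometric_of_lt_one hr0 hr1).sum_le_tsum _ (fun _ _ => by positivity)
        · exact pow_le_one₀ hr0 hr1.le
    _ = _ := by ring

/-- projected, rescaled corner -/
def T (b k i : ℕ) (θ : ℝ) (a : ℤ × ℤ) : ℝ :=
  pr θ ((a.1:ℝ) * (b:ℝ)^i / (b:ℝ)^k) ((a.2:ℝ) * (b:ℝ)^i / (b:ℝ)^k)

lemma T_sub (b k i : ℕ) (θ : ℝ) (a a' : ℤ × ℤ) : T b k i θ a - T b k i θ a' =
    pr θ (((a.1:ℝ) - a'.1) * (b:ℝ)^i / (b:ℝ)^k) (((a.2:ℝ)-a'.2) * (b:ℝ)^i / (b:ℝ)^k) := by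
  unfold T pr; ring

lemma T_cont (b k i : ℕ) (a : ℤ × ℤ) : Continuous fun θ => T b k i θ a := by
  unfold T pr; fun_prop

def G (b : ℕ) (β : ℝ) (P : Finset (ℤ × ℤ)) (k i : ℕ) (θ : ℝ) : ℝ :=
  ((b:ℝ)^i / β^k)^2 * ∑ a ∈ P, ∑ a' ∈ P, Ker ((b:ℝ)/4) (T b k i θ a - T b k i θ a')

lemma G_cont {b : ℕ} (hb : 4 ≤ b) (β : ℝ) (P : Finset (ℤ × ℤ)) (k i : ℕ) :
    Continuous (G b β P k i) := by
  have hq : (1:ℝ) ≤ (b:ℝ)/4 := by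
    have : (4:ℝ) ≤ b := by exact_mod_cast hb
    linarith
  unfold G
  have := Ker_cont hq
  have := T_cont b k i
  fun_prop

lemma G_eq {b : ℕ} (hb : 4 ≤ b) (β : ℝ) (P : Finset (ℤ × ℤ)) (k i : ℕ) (θ : ℝ) :
    Integrable (fun y => ((b:ℝ)^i / β^k * ∑ a ∈ P, psi ((b:ℝ)/4) (y - T b k i θ a))^2) ∧
    G b β P k i θ = ∫ y, ((b:ℝ)^i / β^k * ∑ a ∈ P, psi ((b:ℝ)/4) (y - T b k i θ a))^2 := by
  have hq : (1:ℝ) ≤ (b:ℝ)/4 := by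
    have : (4:ℝ) ≤ b := by exact_mod_cast hb
    linarith
  obtain ⟨h1, h2⟩ := sq_integral P (fun a => T b k i θ a) hq
  simp_rw [mul_pow]
  refine ⟨h1.const_mul _, ?_⟩
  rw [integral_const_mul, h2]; rfl

lemma G_nonneg {b : ℕ} (hb : 4 ≤ b) (β : ℝ) (P : Finset (ℤ × ℤ)) (k i : ℕ) (θ : ℝ) :
    0 ≤ G b β P k i θ := by
  rw [(G_eq hb β P k i θ).2]
  exact integral_nonneg fun y => sq_nonneg _

lemma energy {b : ℕ} (hb : 4 ≤ b) {β : ℝ} (hβ : 1 ≤ β) (hβ3 : β < (b:ℝ)^3) :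
    ∃ C : ℝ, 0 ≤ C ∧ ∀ (P : Finset (ℤ × ℤ)) (k i : ℕ), i ≤ k → ((P.card : ℝ) ≤ β^k) →
    (∀ i, i ≤ k → ∀ a', ((P.filter (fun x => par b (k-i) x = a')).card : ℝ) ≤ β^(k-i)) →
    ∫ θ in (-Real.pi)..Real.pi, G b β P k i θ ≤ C * ((b:ℝ)^2/β)^i := by
  have hq : (1:ℝ) ≤ (b:ℝ)/4 := by
    have : (4:ℝ) ≤ b := by exact_mod_cast hb
    linarith
  have hβ0 : 0 < β := by linarith
  obtain ⟨C1, hC1, h1⟩ := Ker_circle hq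
  obtain ⟨C2, hC2, h2⟩ := shell_sum (by omega : 2 ≤ b) hβ hβ3
  refine ⟨C1 * C2, by positivity, fun P k i hik hP hKT => ?_⟩
  have hcont : ∀ a a', Continuous fun θ => Ker ((b:ℝ)/4) (T b k i θ a - T b k i θ a') := by
    intro a a'
    have := Ker_cont hq
    have := T_cont b k i
    fun_prop
  unfold G
  rw [intervalIntegral.integral_const_mul, intervalIntegral.integral_finsetSum]
  swap
  · intro a _
    exact (continuous_finsetSum _ fun a' _ => hcont a a').intervalIntegrable _ _
  have h3 : ∀ a ∈ P, ∫ θ in (-Real.pi)..Real.pi, ∑ a' ∈ P, Ker ((b:ℝ)/4) (T b k i θ a - T b k i θ a')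
      ≤ C1 * C2 * β^(k-i) := by
    intro a _
    rw [intervalIntegral.integral_finsetSum (fun a' _ => (hcont a a').intervalIntegrable _ _)]
    calc _ ≤ ∑ a' ∈ P, C1 * (1 / (1 + Mx b k i a a')^3) := by
          refine Finset.sum_le_sum fun a' _ => ?_
          simp_rw [T_sub]
          refine (h1 _ _).trans (le_of_eq ?_)
          unfold Mx; ring
      _ = C1 * ∑ a' ∈ P, (1 / (1 + Mx b k i a a')^3) := by rw [Finset.mul_sum]
      _ ≤ C1 * (C2 * β^(k-i)) := by gcongr; exact h2 P k i hik hP hKT a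
      _ = _ := by ring
  calc _ ≤ ((b:ℝ)^i / β^k)^2 * ∑ a ∈ P, C1 * C2 * β^(k-i) := by
        gcongr with a ha; exact h3 a ha
    _ = ((b:ℝ)^i / β^k)^2 * (P.card * (C1 * C2 * β^(k-i))) := by simp
    _ ≤ ((b:ℝ)^i / β^k)^2 * (β^k * (C1 * C2 * β^(k-i))) := by gcongr
    _ = _ := by
        rw [show β^k = β^(k-i) * β^i by rw [← pow_add]; congr 1; omega]
        rw [div_pow, div_pow, ← pow_mul (b:ℝ) 2 i]
        field_simp
        ring

/-- set of bad unit intervals -/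
def J (b : ℕ) (β : ℝ) (P : Finset (ℤ × ℤ)) (k i : ℕ) (θ : ℝ) : Set ℤ :=
  {j | ∀ y ∈ Ico (j:ℝ) (j+1), 1 ≤ (b:ℝ)^i / β^k * ∑ a ∈ P, psi ((b:ℝ)/4) (y - T b k i θ a)}

open Classical in
lemma J_count {b : ℕ} (hb : 4 ≤ b) (β : ℝ) (P : Finset (ℤ × ℤ)) (k i : ℕ) (θ : ℝ) :
    ∑' j : ℤ, (if j ∈ J b β P k i θ then (1:ℝ≥0∞) else 0) ≤ ENNReal.ofReal (G b β P k i θ) := by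
  obtain ⟨h1, h2⟩ := G_eq hb β P k i θ
  rw [h2, ofReal_integral_eq_lintegral_ofReal h1 (Filter.Eventually.of_forall fun y => sq_nonneg _),
    ← setLIntegral_univ, ← iUnion_Ico_intCast ℝ, lintegral_iUnion (fun _ => measurableSet_Ico)
      (pairwise_disjoint_Ico_intCast ℝ)]
  apply ENNReal.tsum_le_tsum
  intro j
  split_ifs with hj
  · calc (1:ℝ≥0∞) = ∫⁻ y in Ico (j:ℝ) (j+1), 1 := by simp
      _ ≤ _ := by
        apply setLIntegral_mono' measurableSet_Ico
        intro y hy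
        rw [ENNReal.one_le_ofReal]
        exact one_le_pow₀ (hj y hy)
  · exact zero_le

open Classical in
/-- counting function -/
def Nc (b : ℕ) (P : Finset (ℤ × ℤ)) (k : ℕ) (θ x : ℝ) (i : ℕ) : ℝ :=
  ((P.filter (fun a => |x * (b:ℝ)^i - T b k i θ a| ≤ 2)).card : ℝ)

lemma T_succ (b k i : ℕ) (θ : ℝ) (a : ℤ × ℤ) : T b k (i+1) θ a = T b k i θ a * b := by
  unfold T pr; ring

lemma mem_J {b : ℕ} (hb : 4 ≤ b) {β : ℝ} (hβ : 1 ≤ β) (P : Finset (ℤ × ℤ)) (k i : ℕ) (θ x : ℝ)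
    (h : 4 * (Nc b P k θ x i * (b:ℝ)^i / β^k) + 1 ≤ Nc b P k θ x (i+1) * (b:ℝ)^(i+1) / β^k) :
    ⌊x * (b:ℝ)^(i+1)⌋ ∈ J b β P k (i+1) θ := by
  classical
  have hb4 : (4:ℝ) ≤ b := by exact_mod_cast hb
  have hb0 : (0:ℝ) < b := by linarith
  have hβ0 : 0 < β := by linarith
  intro y hy
  set y0 := x * (b:ℝ)^(i+1) with hy0
  have hd : |y - y0| ≤ 1 := by
    have h1 := Int.floor_le y0
    have h2 := Int.lt_floor_add_one y0
    rw [abs_le]; constructor <;> linarith [hy.1, hy.2]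
  have hpt : ∀ a, (if |y0 - T b k (i+1) θ a| ≤ 2 then (1:ℝ) else 0) -
      (4 / b) * (if |x * (b:ℝ)^i - T b k i θ a| ≤ 2 then (1:ℝ) else 0) ≤ psi ((b:ℝ)/4) (y - T b k (i+1) θ a) := by
    intro a
    have h1 : (if |y0 - T b k (i+1) θ a| ≤ 2 then (1:ℝ) else 0) ≤ phi (y - T b k (i+1) θ a) := by
      split_ifs with h
      · rw [phi_one]
        calc |y - T b k (i+1) θ a| = |(y - y0) + (y0 - T b k (i+1) θ a)| := by ring_nf
          _ ≤ 1 + 2 := (abs_add_le _ _).trans (add_le_add hd h)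
          _ = 3 := by norm_num
      · exact phi_nonneg _
    have h2 : phi ((y - T b k (i+1) θ a) / ((b:ℝ)/4)) ≤
        (if |x * (b:ℝ)^i - T b k i θ a| ≤ 2 then (1:ℝ) else 0) := by
      split_ifs with h
      · exact phi_le_one _
      · rw [phi_zero]
        push Not at h
        have e : y0 - T b k (i+1) θ a = (x * (b:ℝ)^i - T b k i θ a) * b := by
          rw [hy0, T_succ]; ring
        have h3 : 2 * (b:ℝ) < |y0 - T b k (i+1) θ a| := by
          rw [e, abs_mul, abs_of_pos hb0]; gcongr
        have h4 : |y0 - T b k (i+1) θ a| ≤ |y - y0| + |y - T b k (i+1) θ a| := by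
          rw [abs_sub_comm y y0]
          calc _ = |(y0 - y) + (y - T b k (i+1) θ a)| := by ring_nf
            _ ≤ _ := abs_add_le _ _
        rw [abs_div, abs_of_pos (by positivity : 0 < (b:ℝ)/4), le_div_iff₀ (by positivity)]
        linarith
    unfold psi
    have h3 : phi ((y - T b k (i+1) θ a) / ((b:ℝ)/4)) / ((b:ℝ)/4) ≤
        (4 / b) * (if |x * (b:ℝ)^i - T b k i θ a| ≤ 2 then (1:ℝ) else 0) := by
      calc _ = (4/b) * phi ((y - T b k (i+1) θ a) / ((b:ℝ)/4)) := by field_simp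
        _ ≤ _ := by gcongr
    linarith
  have hs := Finset.sum_le_sum (s := P) (fun a _ => hpt a)
  rw [Finset.sum_sub_distrib, ← Finset.mul_sum, Finset.sum_boole, Finset.sum_boole] at hs
  change Nc b P k θ x (i+1) - 4 / b * Nc b P k θ x i ≤ _ at hs
  calc (1:ℝ) ≤ Nc b P k θ x (i+1) * (b:ℝ)^(i+1) / β^k - 4 * (Nc b P k θ x i * (b:ℝ)^i / β^k) := by linarith
    _ = (b:ℝ)^(i+1) / β^k * (Nc b P k θ x (i+1) - 4 / b * Nc b P k θ x i) := by
        rw [pow_succ]; field_simp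
    _ ≤ _ := by gcongr

lemma chain {b N : ℕ} (hN : 1 ≤ N) (hbN : b = 4^N) {β lam : ℝ} (hβ : 1 ≤ β)
    (hl : 64 ≤ lam * b / β) (P : Finset (ℤ × ℤ)) (k : ℕ) (hk : 1 ≤ k) (hP : (P.card : ℝ) ≤ β^k) (θ x : ℝ)
    (h : lam^k < Nc b P k θ x k) :
    ∃ i, i ≤ k ∧ k < N * i ∧ ⌊x * (b:ℝ)^i⌋ ∈ J b β P k i θ := by
  classical
  have hb : 4 ≤ b := by
    rw [hbN]; calc 4 = 4^1 := rfl
      _ ≤ _ := Nat.pow_le_pow_right (by norm_num) hN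
  have hb4 : (4:ℝ) ≤ b := by exact_mod_cast hb
  have hb0 : (0:ℝ) < b := by linarith
  have hβ0 : 0 < β := by linarith
  by_contra hcon
  push Not at hcon
  set D : ℕ → ℝ := fun i => Nc b P k θ x i * (b:ℝ)^i / β^k with hD
  set i0 := k / N with hi0
  have hstep : ∀ i, i0 ≤ i → i + 1 ≤ k → D (i+1) < 4 * D i + 1 := by
    intro i hi hik
    by_contra hh
    push Not at hh
    refine hcon (i+1) hik ?_ (mem_J hb hβ P k i θ x hh)
    have h1 : k / N < i + 1 := by omega
    have := (Nat.div_lt_iff_lt_mul (by omega : 0 < N)).1 h1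
    rwa [mul_comm] at this
  have hi0k : i0 ≤ k := Nat.div_le_self _ _
  have hind : ∀ m, i0 + m ≤ k → D (i0 + m) + 1 ≤ 4^m * (D i0 + 1) := by
    intro m
    induction m with
    | zero => intro _; simp
    | succ m ih =>
      intro hm
      have h1 := ih (by omega)
      have h2 := hstep (i0 + m) (by omega) (by omega)
      rw [show i0 + (m+1) = i0 + m + 1 by ring]
      calc D (i0 + m + 1) + 1 ≤ 4 * (D (i0+m) + 1) := by linarith
        _ ≤ 4 * (4^m * (D i0 + 1)) := by gcongr
        _ = _ := by ring
  have h1 := hind (k - i0) (by omega)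
  rw [show i0 + (k - i0) = k by omega] at h1
  have hD0 : D i0 ≤ 4^k := by
    have hc : Nc b P k θ x i0 ≤ β^k := by
      refine le_trans ?_ hP
      unfold Nc
      exact_mod_cast Finset.card_filter_le _ _
    have hbi : (b:ℝ)^i0 ≤ 4^k := by
      rw [hbN]; push_cast
      rw [← pow_mul]
      exact pow_le_pow_right₀ (by norm_num) (Nat.mul_div_le k N)
    calc D i0 ≤ β^k * (b:ℝ)^i0 / β^k := by simp only [hD]; gcongr
      _ = (b:ℝ)^i0 := by field_simp
      _ ≤ _ := hbi
  have h2 : (4:ℝ)^(k-i0) ≤ 4^k := pow_le_pow_right₀ (by norm_num) (Nat.sub_le _ _)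
  have h41 : (1:ℝ) ≤ 4^k := one_le_pow₀ (by norm_num)
  have h3 : D k < 2 * 16^k := by
    have : (4:ℝ)^(k-i0) * (D i0 + 1) ≤ 4^k * (4^k + 4^k) := by
      have hDn : 0 ≤ D i0 := by simp only [hD]; unfold Nc; positivity
      apply mul_le_mul h2 (by linarith) (by linarith) (by positivity)
    have e : (4:ℝ)^k * (4^k + 4^k) = 2 * 16^k := by
      rw [show (16:ℝ) = 4 * 4 by norm_num, mul_pow]; ring
    linarith
  have h4 : 64^k ≤ D k := by
    calc (64:ℝ)^k ≤ (lam * b / β)^k := by gcongr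
      _ = lam^k * b^k / β^k := by rw [div_pow, mul_pow]
      _ ≤ D k := by simp only [hD]; gcongr
  have h5 : (2:ℝ) * 16^k ≤ 64^k := by
    rw [show (64:ℝ) = 4 * 16 by norm_num, mul_pow]
    gcongr
    calc (2:ℝ) ≤ 4^1 := by norm_num
      _ ≤ 4^k := pow_le_pow_right₀ (by norm_num) hk
  linarith

end Heavy


namespace Heavy

/-- projection along the line -/
def qr (θ x y : ℝ) : ℝ := Real.cos θ * x + Real.sin θ * y

lemma rot (θ x y : ℝ) : pr θ x y ^ 2 + qr θ x y ^ 2 = x^2 + y^2 := by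
  unfold pr qr
  have := Real.sin_sq_add_cos_sq θ
  linear_combination (x^2 + y^2) * this

lemma dist_le_pq (θ : ℝ) (z w : Plane) {c : ℝ}
    (hp : |pr θ (z 0) (z 1) - pr θ (w 0) (w 1)| ≤ c)
    (hq : |qr θ (z 0) (z 1) - qr θ (w 0) (w 1)| ≤ c) : dist z w ≤ 2 * c := by
  have hc : 0 ≤ c := (abs_nonneg _).trans hp
  rw [EuclideanSpace.dist_eq]
  apply Real.sqrt_le_iff.2 ⟨by positivity, ?_⟩
  rw [Fin.sum_univ_two, Real.dist_eq, Real.dist_eq, sq_abs, sq_abs, ← rot θ]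
  have e1 : pr θ (z 0 - w 0) (z 1 - w 1) = pr θ (z 0) (z 1) - pr θ (w 0) (w 1) := by
    unfold pr; ring
  have e2 : qr θ (z 0 - w 0) (z 1 - w 1) = qr θ (z 0) (z 1) - qr θ (w 0) (w 1) := by
    unfold qr; ring
  rw [e1, e2, ← sq_abs, ← sq_abs (qr _ _ _ - _)]
  have h1 := pow_le_pow_left₀ (abs_nonneg _) hp 2
  have h2 := pow_le_pow_left₀ (abs_nonneg _) hq 2
  nlinarith

lemma floor_close {x y c : ℝ} (hc : 0 < c) (h : ⌊x * c⌋ = ⌊y * c⌋) : |x - y| ≤ 1 / c := by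
  have := Int.abs_sub_lt_one_of_floor_eq_floor h
  rw [← sub_mul, abs_mul, abs_of_pos hc] at this
  rw [le_div_iff₀ hc]; exact this.le

lemma ediam_pq (θ : ℝ) {c : ℝ} (hc : 0 < c) (S : Set Plane)
    (h : ∀ z ∈ S, ∀ w ∈ S, ⌊pr θ (z 0) (z 1) * c⌋ = ⌊pr θ (w 0) (w 1) * c⌋ ∧
      ⌊qr θ (z 0) (z 1) * c⌋ = ⌊qr θ (w 0) (w 1) * c⌋) :
    Metric.ediam S ≤ ENNReal.ofReal (2 * (1 / c)) := by
  apply Metric.ediam_le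
  intro z hz w hw
  rw [edist_dist]
  apply ENNReal.ofReal_le_ofReal
  obtain ⟨h1, h2⟩ := h z hz w hw
  exact dist_le_pq θ z w (floor_close hc h1) (floor_close hc h2)

lemma ediam_idx {b : ℕ} (hb : 1 ≤ b) (k : ℕ) (a : ℤ × ℤ) :
    Metric.ediam {z : Plane | idx b k z = a} ≤ ENNReal.ofReal (2 * (1 / (b:ℝ)^k)) := by
  have hb0 : (0:ℝ) < (b:ℝ)^k := by positivity
  apply ediam_pq 0 hb0
  intro z hz w hw
  have h : idx b k z = idx b k w := by rw [hz, hw]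
  unfold idx at h
  simp only [Prod.mk.injEq] at h
  simp [pr, qr, h.1, h.2]

lemma near_corner {b : ℕ} (hb : 1 ≤ b) (k : ℕ) (θ : ℝ) (z : Plane) :
    |pr θ (z 0) (z 1) * (b:ℝ)^k - T b k k θ (idx b k z)| ≤ 2 := by
  have hb0 : (0:ℝ) < (b:ℝ)^k := by positivity
  have e : pr θ (z 0) (z 1) * (b:ℝ)^k - T b k k θ (idx b k z) =
      -Real.sin θ * Int.fract (z 0 * (b:ℝ)^k) + Real.cos θ * Int.fract (z 1 * (b:ℝ)^k) := by
    unfold T pr idx Int.fract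
    simp only []
    rw [mul_div_cancel_right₀ _ hb0.ne', mul_div_cancel_right₀ _ hb0.ne']
    ring
  rw [e]
  refine (abs_add_le _ _).trans ?_
  rw [abs_mul, abs_mul, abs_neg, abs_of_nonneg (Int.fract_nonneg (z 0 * (b:ℝ)^k)),
    abs_of_nonneg (Int.fract_nonneg (z 1 * (b:ℝ)^k))]
  have := Real.abs_sin_le_one θ
  have := Real.abs_cos_le_one θ
  have := Int.fract_nonneg (z 0 * (b:ℝ)^k)
  have := Int.fract_nonneg (z 1 * (b:ℝ)^k)
  have := (Int.fract_lt_one (z 0 * (b:ℝ)^k)).le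
  have := (Int.fract_lt_one (z 1 * (b:ℝ)^k)).le
  have h1 : |Real.sin θ| * Int.fract (z 0 * (b:ℝ)^k) ≤ 1 * 1 := by gcongr
  have h2 : |Real.cos θ| * Int.fract (z 1 * (b:ℝ)^k) ≤ 1 * 1 := by gcongr
  linarith

lemma tail_tendsto (f : ℕ → ℝ≥0∞) (hf : ∑' k, f k ≠ ∞) :
    Filter.Tendsto (fun n => ∑' k, if n < k then f k else 0) Filter.atTop (nhds 0) := by
  have h := ENNReal.tendsto_sum_nat_add f hf
  have h2 := h.comp (Filter.tendsto_add_atTop_nat 1)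
  refine h2.congr fun n => ?_
  simp only [Function.comp]
  rw [← ENNReal.summable.sum_add_tsum_nat_add' (f := fun k => if n < k then f k else 0) (k := n+1)]
  rw [Finset.sum_eq_zero, zero_add]
  · refine tsum_congr fun k => ?_
    rw [if_pos (by omega)]
  · intro k hk
    rw [Finset.mem_range] at hk
    rw [if_neg (by omega)]

open Classical in
lemma slice (A : Set Plane) {b : ℕ} (hb : 2 ≤ b) {lam σ : ℝ} (hlam : 0 < lam) (hσ : 0 < σ)
    (hls : lam < (b:ℝ)^σ) (P : ℕ → ℕ → Finset (ℤ × ℤ)) (hP0 : ∀ n k, k ≤ n → P n k = ∅)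
    (hcov : ∀ n, ∀ z ∈ A, ∃ k, idx b k z ∈ P n k) (θ x : ℝ)
    (hne : μH[σ] (A ∩ {w : Plane | pr θ (w 0) (w 1) = x}) ≠ 0) :
    ∃ n0, ∀ n ≥ n0, ∃ k, n < k ∧ lam^k < Nc b (P n k) k θ x k := by
  by_contra hcon
  push Not at hcon
  apply hne
  have hb1 : (1:ℝ) < b := by exact_mod_cast hb
  have hb0 : (0:ℝ) < b := by linarith
  set B := (b:ℝ) with hB
  set tt : ℕ → ℕ × (ℤ × ℤ) → Set Plane := fun n p =>
    if p.2 ∈ P n p.1 ∧ |x * B^p.1 - T b p.1 p.1 θ p.2| ≤ 2 then {z | idx b p.1 z = p.2} else ∅ with htt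
  set f : ℕ → ℝ≥0∞ := fun k => ENNReal.ofReal (lam^k * (2 * (1 / B^k))^σ) with hf
  have hBs : 0 < B^σ := by positivity
  have hfs : ∑' k, f k ≠ ∞ := by
    have e : ∀ k, lam^k * (2 * (1 / B^k))^σ = 2^σ * (lam / B^σ)^k := by
      intro k
      rw [Real.mul_rpow (by norm_num) (by positivity), Real.div_rpow (by norm_num) (by positivity),
        Real.one_rpow, div_pow, ← Real.rpow_natCast B k, ← Real.rpow_mul hb0.le, mul_comm (k:ℝ) σ,
        Real.rpow_mul hb0.le, Real.rpow_natCast]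
      ring
    simp only [hf, e]
    have hs : Summable fun k : ℕ => (2:ℝ)^σ * (lam / B^σ)^k :=
      (summable_geometric_of_lt_one (by positivity) ((div_lt_one hBs).2 hls)).mul_left _
    exact hs.tsum_ofReal_ne_top
  have hdiam : ∀ n p, Metric.ediam (tt n p) ≤
      if p.2 ∈ P n p.1 ∧ |x * B^p.1 - T b p.1 p.1 θ p.2| ≤ 2 then ENNReal.ofReal (2 * (1 / B^p.1)) else 0 := by
    intro n p
    simp only [htt]
    split_ifs
    · exact ediam_idx (by omega) _ _
    · simp
  have key := Measure.hausdorffMeasure_le_liminf_tsum σ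
    (A ∩ {w : Plane | pr θ (w 0) (w 1) = x}) (l := Filter.atTop)
    (fun n : ℕ => ENNReal.ofReal (2 * (1 / B)^n)) ?_ tt ?_ ?_
  · refine le_antisymm (key.trans ?_) (zero_le)
    apply ENNReal.le_of_forall_pos_le_add
    intro ε hε _
    rw [zero_add]
    have htail := (tail_tendsto f hfs).eventually (gt_mem_nhds (show (0:ℝ≥0∞) < ε by exact_mod_cast hε))
    apply Filter.liminf_le_of_frequently_le'
    rw [Filter.frequently_atTop]
    intro m
    obtain ⟨m1, hm1⟩ := Filter.eventually_atTop.1 htail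
    obtain ⟨n, hn, hnk⟩ := hcon (max m m1)
    refine ⟨n, le_trans (le_max_left _ _) hn, ?_⟩
    refine le_trans ?_ (hm1 n (le_trans (le_max_right _ _) hn)).le
    rw [ENNReal.tsum_prod (f := fun k a => Metric.ediam (tt n (k, a))^σ)]
    refine ENNReal.tsum_le_tsum fun k => ?_
    calc ∑' a, Metric.ediam (tt n (k, a))^σ
        ≤ ∑' a, if a ∈ (P n k).filter (fun a => |x * B^k - T b k k θ a| ≤ 2)
            then ENNReal.ofReal ((2 * (1 / B^k))^σ) else 0 := by
          refine ENNReal.tsum_le_tsum fun a => ?_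
          have h1 := ENNReal.rpow_le_rpow (hdiam n (k, a)) hσ.le
          refine h1.trans ?_
          simp only [Finset.mem_filter]
          split_ifs
          · rw [ENNReal.ofReal_rpow_of_nonneg (by positivity) hσ.le]
          · rw [ENNReal.zero_rpow_of_pos hσ]
      _ = ENNReal.ofReal (Nc b (P n k) k θ x k * (2 * (1 / B^k))^σ) := by
          rw [tsum_eq_sum (s := (P n k).filter (fun a => |x * B^k - T b k k θ a| ≤ 2))
            (fun a ha => if_neg ha), Finset.sum_congr rfl (fun a ha => if_pos ha)]
          rw [Finset.sum_const, nsmul_eq_mul, ENNReal.ofReal_mul (by unfold Nc; positivity)]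
          unfold Nc
          rw [ENNReal.ofReal_natCast]
      _ ≤ _ := by
          split_ifs with h
          · apply ENNReal.ofReal_le_ofReal
            gcongr
            exact hnk k h
          · rw [hP0 n k (by omega)]; simp [Nc]
  · have h := (tendsto_pow_atTop_nhds_zero_of_lt_one (r := 1 / B) (by positivity)
      ((div_lt_one hb0).2 hb1)).const_mul 2
    have := ENNReal.tendsto_ofReal h
    simpa using this
  · refine Filter.Eventually.of_forall fun n p => (hdiam n p).trans ?_
    split_ifs with h
    · apply ENNReal.ofReal_le_ofReal
      have hk : n ≤ p.1 := by
        by_contra hk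
        rw [hP0 n p.1 (by omega)] at h
        simp at h
      rw [one_div_pow]
      gcongr
      exact hb1.le
    · exact zero_le
  · refine Filter.Eventually.of_forall fun n z hz => ?_
    obtain ⟨k, hk⟩ := hcov n z hz.1
    rw [mem_iUnion]
    refine ⟨(k, idx b k z), ?_⟩
    have hn := near_corner (by omega : 1 ≤ b) k θ z
    rw [hz.2] at hn
    simp only [htt]
    rw [if_pos ⟨hk, hn⟩]
    rfl

end Heavy


namespace Heavy

lemma abs_qr_le (θ : ℝ) (z : Plane) : |qr θ (z 0) (z 1)| ≤ ‖z‖ := by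
  rw [EuclideanSpace.norm_eq]
  apply Real.le_sqrt_of_sq_le
  rw [Fin.sum_univ_two, Real.norm_eq_abs, Real.norm_eq_abs, sq_abs, sq_abs, sq_abs, ← rot θ]
  nlinarith [sq_nonneg (pr θ (z 0) (z 1))]

/-- total covering cost at stage `n` -/
def cost (N b M : ℕ) (β u : ℝ) (P : ℕ → ℕ → Finset (ℤ × ℤ)) (n : ℕ) (θ : ℝ) : ℝ≥0∞ :=
  ∑' k : ℕ, ∑' i : ℕ, if n < k ∧ i ≤ k ∧ k < N * i then
    ENNReal.ofReal (G b β (P n k) k i θ) *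
      ENNReal.ofReal ((2*M+3) * (b:ℝ)^i * (2 * (1 / (b:ℝ)^i))^u) else 0

open Classical in
lemma det {b N : ℕ} (hN : 1 ≤ N) (hbN : b = 4^N) {β lam u : ℝ} (hβ : 1 ≤ β) (hu : 0 < u)
    (hl : 64 ≤ lam * b / β) (P : ℕ → ℕ → Finset (ℤ × ℤ)) (hP : ∀ n k, ((P n k).card : ℝ) ≤ β^k)
    (M : ℕ) (θ : ℝ) (S : Set Plane) (n0 : ℕ)
    (hS : ∀ z ∈ S, ‖z‖ ≤ M ∧ ∀ n ≥ n0, ∃ k, n < k ∧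
      lam^k < Nc b (P n k) k θ (pr θ (z 0) (z 1)) k) :
    μH[u] S ≤ Filter.liminf (fun n => cost N b M β u P n θ) Filter.atTop := by
  have hb : 4 ≤ b := by
    rw [hbN]; calc 4 = 4^1 := rfl
      _ ≤ _ := Nat.pow_le_pow_right (by norm_num) hN
  have hb4 : (4:ℝ) ≤ b := by exact_mod_cast hb
  have hb0 : (0:ℝ) < b := by linarith
  set tt : ℕ → ℕ × ℕ × ℤ × ℤ → Set Plane := fun n p =>
    if (n < p.1 ∧ p.2.1 ≤ p.1 ∧ p.1 < N * p.2.1) ∧ p.2.2.1 ∈ J b β (P n p.1) p.1 p.2.1 θ ∧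
      p.2.2.2 ∈ Finset.Icc (-((((M+1) * b^p.2.1 : ℕ)):ℤ)) (((M+1) * b^p.2.1 : ℕ):ℤ)
    then {z | ⌊pr θ (z 0) (z 1) * (b:ℝ)^p.2.1⌋ = p.2.2.1 ∧ ⌊qr θ (z 0) (z 1) * (b:ℝ)^p.2.1⌋ = p.2.2.2}
    else ∅ with htt
  have hdiam : ∀ n p, Metric.ediam (tt n p) ≤
      if (n < p.1 ∧ p.2.1 ≤ p.1 ∧ p.1 < N * p.2.1) ∧ p.2.2.1 ∈ J b β (P n p.1) p.1 p.2.1 θ ∧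
      p.2.2.2 ∈ Finset.Icc (-((((M+1) * b^p.2.1 : ℕ)):ℤ)) (((M+1) * b^p.2.1 : ℕ):ℤ)
      then ENNReal.ofReal (2 * (1 / (b:ℝ)^p.2.1)) else 0 := by
    intro n p
    simp only [htt]
    split_ifs
    · apply ediam_pq θ (by positivity)
      intro z hz w hw
      exact ⟨hz.1.trans hw.1.symm, hz.2.trans hw.2.symm⟩
    · simp
  have key := Measure.hausdorffMeasure_le_liminf_tsum u S (l := Filter.atTop)
    (fun n : ℕ => ENNReal.ofReal (2 * (1 / 4)^n)) ?_ tt ?_ ?_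
  · refine key.trans ?_
    refine Filter.liminf_le_liminf (Filter.Eventually.of_forall fun n => ?_)
    unfold cost
    rw [ENNReal.tsum_prod (f := fun k a => Metric.ediam (tt n (k, a))^u)]
    refine ENNReal.tsum_le_tsum fun k => ?_
    rw [ENNReal.tsum_prod (f := fun i a => Metric.ediam (tt n (k, i, a))^u)]
    refine ENNReal.tsum_le_tsum fun i => ?_
    rw [ENNReal.tsum_prod (f := fun j a => Metric.ediam (tt n (k, i, j, a))^u)]
    set L : ℤ := (((M+1) * b^i : ℕ):ℤ) with hL
    split_ifs with hc
    · calc ∑' (j : ℤ) (l : ℤ), Metric.ediam (tt n (k, i, j, l))^u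
          ≤ ∑' (j : ℤ) (l : ℤ), (if j ∈ J b β (P n k) k i θ then (1:ℝ≥0∞) else 0) *
            (if l ∈ Finset.Icc (-L) L then ENNReal.ofReal ((2 * (1 / (b:ℝ)^i))^u) else 0) := by
            refine ENNReal.tsum_le_tsum fun j => ENNReal.tsum_le_tsum fun l => ?_
            refine (ENNReal.rpow_le_rpow (hdiam n (k, i, j, l)) hu.le).trans ?_
            simp only [← hL]
            by_cases h1 : j ∈ J b β (P n k) k i θ
            · by_cases h2 : l ∈ Finset.Icc (-L) L
              · rw [if_pos ⟨hc, h1, h2⟩, if_pos h1, if_pos h2, one_mul,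
                  ENNReal.ofReal_rpow_of_nonneg (by positivity) hu.le]
              · rw [if_neg (fun h => h2 h.2.2), ENNReal.zero_rpow_of_pos hu]; exact zero_le
            · rw [if_neg (fun h => h1 h.2.1), ENNReal.zero_rpow_of_pos hu]; exact zero_le
        _ = (∑' j : ℤ, (if j ∈ J b β (P n k) k i θ then (1:ℝ≥0∞) else 0)) *
            ∑' l : ℤ, (if l ∈ Finset.Icc (-L) L then ENNReal.ofReal ((2 * (1 / (b:ℝ)^i))^u) else 0) := by
            rw [← ENNReal.tsum_mul_right]
            exact tsum_congr fun j => ENNReal.tsum_mul_left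
        _ ≤ _ := by
            apply mul_le_mul' (J_count hb β (P n k) k i θ)
            rw [tsum_eq_sum (s := Finset.Icc (-L) L) (fun a ha => if_neg ha),
              Finset.sum_congr rfl (fun a ha => if_pos ha), Finset.sum_const, nsmul_eq_mul,
              ENNReal.ofReal_mul (by positivity)]
            gcongr
            rw [← ENNReal.ofReal_natCast]
            apply ENNReal.ofReal_le_ofReal
            rw [Int.card_Icc]
            have e : (L + 1 - -L).toNat = 2 * ((M+1) * b^i) + 1 := by omega
            rw [e]
            push_cast
            have : (1:ℝ) ≤ (b:ℝ)^i := one_le_pow₀ (by linarith)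
            linarith
    · rw [nonpos_iff_eq_zero]
      simp only [ENNReal.tsum_eq_zero]
      intro j l
      have h1 := hdiam n (k, i, j, l)
      rw [if_neg (fun h => hc h.1)] at h1
      rw [nonpos_iff_eq_zero.1 h1, ENNReal.zero_rpow_of_pos hu]
  · have h := (tendsto_pow_atTop_nhds_zero_of_lt_one (r := (1:ℝ) / 4) (by positivity)
      (by norm_num)).const_mul 2
    have := ENNReal.tendsto_ofReal h
    simpa using this
  · refine Filter.Eventually.of_forall fun n p => (hdiam n p).trans ?_
    split_ifs with h
    · apply ENNReal.ofReal_le_ofReal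
      rw [one_div_pow]
      gcongr
      rw [hbN]; push_cast
      rw [← pow_mul]
      exact pow_le_pow_right₀ (by norm_num) (by omega)
    · exact zero_le
  · refine Filter.eventually_atTop.2 ⟨n0, fun n hn z hz => ?_⟩
    obtain ⟨hz1, hz2⟩ := hS z hz
    obtain ⟨k, hk, hk2⟩ := hz2 n hn
    obtain ⟨i, hi, hi2, hi3⟩ := chain hN hbN hβ hl (P n k) k (by omega) (hP n k) θ _ hk2
    rw [mem_iUnion]
    refine ⟨(k, i, ⌊pr θ (z 0) (z 1) * (b:ℝ)^i⌋, ⌊qr θ (z 0) (z 1) * (b:ℝ)^i⌋), ?_⟩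
    simp only [htt]
    rw [if_pos]
    · exact ⟨rfl, rfl⟩
    · refine ⟨⟨hk, hi, hi2⟩, hi3, ?_⟩
      rw [Finset.mem_Icc]
      have h1 := abs_le.1 ((abs_qr_le θ z).trans hz1)
      have hbi : (1:ℝ) ≤ (b:ℝ)^i := one_le_pow₀ (by linarith)
      have h2 : qr θ (z 0) (z 1) * (b:ℝ)^i ≤ M * (b:ℝ)^i := by gcongr; exact h1.2
      have h3 : -(M:ℝ) * (b:ℝ)^i ≤ qr θ (z 0) (z 1) * (b:ℝ)^i := by gcongr; exact h1.1
      have h4 := Int.floor_le (qr θ (z 0) (z 1) * (b:ℝ)^i)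
      have h5 := Int.lt_floor_add_one (qr θ (z 0) (z 1) * (b:ℝ)^i)
      constructor
      · rw [← Int.cast_le (R := ℝ)]; push_cast; nlinarith
      · rw [← Int.cast_le (R := ℝ)]; push_cast; nlinarith

end Heavy


namespace Heavy

lemma cost_meas (N b M : ℕ) (hb : 4 ≤ b) (β u : ℝ) (P : ℕ → ℕ → Finset (ℤ × ℤ)) (n : ℕ) :
    Measurable (cost N b M β u P n) := by
  unfold cost
  refine Measurable.tsum fun k => Measurable.tsum fun i => ?_
  split_ifs
  · exact ((G_cont hb β (P n k) k i).measurable.ennreal_ofReal).mul_const _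
  · exact measurable_const

lemma cost_ae {b N : ℕ} (hb : 4 ≤ b) {β u : ℝ} (hβ : 1 ≤ β) (hβ3 : β < (b:ℝ)^3)
    (hu : (b:ℝ)^3 < β * (b:ℝ)^u) (P : ℕ → ℕ → Finset (ℤ × ℤ)) (hP : ∀ n k, ((P n k).card : ℝ) ≤ β^k)
    (hKT : ∀ n k i, i ≤ k → ∀ a', (((P n k).filter (fun x => par b (k-i) x = a')).card : ℝ) ≤ β^(k-i))
    (M : ℕ) :
    ∀ᵐ θ ∂(volume.restrict (Ioc (-Real.pi) Real.pi)),
      Filter.liminf (fun n => cost N b M β u P n θ) Filter.atTop = 0 := by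
  obtain ⟨C, hC, hen⟩ := energy hb hβ hβ3
  have hb4 : (4:ℝ) ≤ b := by exact_mod_cast hb
  have hb0 : (0:ℝ) < b := by linarith
  have hβ0 : 0 < β := by linarith
  set γ : ℝ := (b:ℝ)^3 / (β * (b:ℝ)^u) with hγ
  set C' : ℝ := C * ((2*M+3) * 2^u) with hC'
  have hγ0 : 0 ≤ γ := by positivity
  have hγ1 : γ < 1 := (div_lt_one (by positivity)).2 hu
  have hC'0 : 0 ≤ C' := by positivity
  have hpi : -Real.pi ≤ Real.pi := by linarith [Real.pi_pos]
  have hGint : ∀ n k i, i ≤ k → (∫⁻ θ in Ioc (-Real.pi) Real.pi, ENNReal.ofReal (G b β (P n k) k i θ)) ≤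
      ENNReal.ofReal (C * ((b:ℝ)^2/β)^i) := by
    intro n k i hik
    rw [← ofReal_integral_eq_lintegral_ofReal ((G_cont hb β (P n k) k i).integrableOn_Ioc)
      (Filter.Eventually.of_forall fun θ => G_nonneg hb β (P n k) k i θ)]
    apply ENNReal.ofReal_le_ofReal
    rw [← intervalIntegral.integral_of_le hpi]
    exact hen (P n k) k i hik (hP n k) (hKT n k)
  have halg : ∀ i : ℕ, (C * ((b:ℝ)^2/β)^i) * ((2*M+3) * (b:ℝ)^i * (2 * (1 / (b:ℝ)^i))^u) = C' * γ^i := by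
    intro i
    rw [Real.mul_rpow (by norm_num) (by positivity), Real.div_rpow (by norm_num) (by positivity),
        Real.one_rpow, ← Real.rpow_natCast (b:ℝ) i, ← Real.rpow_mul hb0.le, mul_comm (i:ℝ) u,
        Real.rpow_mul hb0.le, Real.rpow_natCast, Real.rpow_natCast, hγ, hC', div_pow, div_pow, mul_pow]
    field_simp
    ring
  set g : ℕ → ℝ≥0∞ := fun k => ∑' i : ℕ, if i ≤ k ∧ k < N * i then ENNReal.ofReal (C' * γ^i) else 0 with hg
  have hgs : ∑' k, g k ≠ ∞ := by
    have h1 : ∑' k, g k ≤ ∑' i : ℕ, ENNReal.ofReal ((N * i : ℕ) * (C' * γ^i)) := by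
      simp only [hg]
      rw [ENNReal.tsum_comm]
      refine ENNReal.tsum_le_tsum fun i => ?_
      calc _ ≤ ∑' k : ℕ, if k ∈ Finset.range (N * i) then ENNReal.ofReal (C' * γ^i) else 0 := by
            refine ENNReal.tsum_le_tsum fun k => ?_
            simp only [Finset.mem_range]
            split_ifs with h1 h2
            · exact le_rfl
            · exact absurd h1.2 h2
            · exact zero_le
            · exact le_rfl
        _ = _ := by
            rw [tsum_eq_sum (s := Finset.range (N * i)) (fun a ha => if_neg ha),
              Finset.sum_congr rfl (fun a ha => if_pos ha), Finset.sum_const, nsmul_eq_mul,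
              ENNReal.ofReal_mul (p := ((N * i : ℕ):ℝ)) (by positivity), ENNReal.ofReal_natCast,
              Finset.card_range]
    refine ne_top_of_le_ne_top ?_ h1
    have hs : Summable fun i : ℕ => ((N * i : ℕ) : ℝ) * (C' * γ^i) := by
      have h := (summable_pow_mul_geometric_of_norm_lt_one 1 (r := γ)
        (by rw [Real.norm_eq_abs, abs_of_nonneg hγ0]; exact hγ1)).mul_left (N * C')
      refine h.congr fun i => ?_
      push_cast; ring
    exact hs.tsum_ofReal_ne_top
  have hbound : ∀ n, (∫⁻ θ in Ioc (-Real.pi) Real.pi, cost N b M β u P n θ) ≤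
      ∑' k, if n < k then g k else 0 := by
    intro n
    unfold cost
    have hm : ∀ k i, Measurable fun θ => (if n < k ∧ i ≤ k ∧ k < N * i then
        ENNReal.ofReal (G b β (P n k) k i θ) *
        ENNReal.ofReal ((2*M+3) * (b:ℝ)^i * (2 * (1 / (b:ℝ)^i))^u) else 0) := by
      intro k i
      split_ifs
      · exact ((G_cont hb β (P n k) k i).measurable.ennreal_ofReal).mul_const _
      · exact measurable_const
    rw [lintegral_tsum (fun k => (Measurable.tsum fun i => hm k i).aemeasurable)]
    refine ENNReal.tsum_le_tsum fun k => ?_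
    rw [lintegral_tsum (fun i => (hm k i).aemeasurable)]
    by_cases hk : n < k
    · rw [if_pos hk]
      simp only [hg]
      refine ENNReal.tsum_le_tsum fun i => ?_
      by_cases hc : i ≤ k ∧ k < N * i
      · simp only [hk, hc, and_self, if_true]
        rw [lintegral_mul_const _ (G_cont hb β (P n k) k i).measurable.ennreal_ofReal, ← halg,
          ENNReal.ofReal_mul (p := C * ((b:ℝ)^2/β)^i) (by positivity)]
        exact mul_le_mul' (hGint n k i hc.1) le_rfl
      · simp only [hc, and_false, if_false, lintegral_zero]; exact le_rfl
    · simp [hk]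
  have hF := lintegral_liminf_le (u := Filter.atTop) (μ := volume.restrict (Ioc (-Real.pi) Real.pi))
    (f := fun n θ => cost N b M β u P n θ) (fun n => cost_meas N b M hb β u P n)
  have ht : Filter.Tendsto (fun n => ∫⁻ θ in Ioc (-Real.pi) Real.pi, cost N b M β u P n θ)
      Filter.atTop (nhds 0) :=
    tendsto_of_tendsto_of_tendsto_of_le_of_le tendsto_const_nhds (tail_tendsto g hgs)
      (fun _ => zero_le) hbound
  rw [ht.liminf_eq, nonpos_iff_eq_zero, lintegral_eq_zero_iff
    (Measurable.liminf fun n => cost_meas N b M hb β u P n)] at hF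
  exact hF

lemma main_null (A : Set Plane) {s η u : ℝ} (hs1 : 1 ≤ s) (hs3 : s < 3) (hη : 0 < η) (hA : μH[s] A = 0)
    (hu : 3 - s < u) (M : ℕ) :
    ∀ᵐ θ ∂(volume.restrict (Ioc (-Real.pi) Real.pi)),
      μH[u] {z : Plane | ‖z‖ ≤ M ∧
        μH[s - 1 + 2 * η] (A ∩ {w : Plane | pr θ (w 0) (w 1) = pr θ (z 0) (z 1)}) ≠ 0} = 0 := by
  obtain ⟨N, hN⟩ := exists_nat_ge (max 1 (3 / η))
  have hN1 : 1 ≤ N := by exact_mod_cast (le_max_left _ _).trans hN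
  have hN2 : 3 ≤ N * η := by
    have := (le_max_right _ _).trans hN
    rwa [div_le_iff₀ hη] at this
  obtain ⟨b, hbN⟩ : ∃ b : ℕ, b = 4^N := ⟨_, rfl⟩
  have hb : 4 ≤ b := by
    rw [hbN]; calc 4 = 4^1 := rfl
      _ ≤ _ := Nat.pow_le_pow_right (by norm_num) hN1
  have hb4 : (4:ℝ) ≤ b := by exact_mod_cast hb
  have hb0 : (0:ℝ) < b := by linarith
  have hb1 : (1:ℝ) < b := by linarith
  have hu0 : 0 < u := by linarith
  have hβ : 1 ≤ (b:ℝ)^s := Real.one_le_rpow hb1.le (by linarith)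
  have h3 : (b:ℝ)^3 = (b:ℝ)^(3:ℝ) := by norm_cast
  have hβ3 : (b:ℝ)^s < (b:ℝ)^3 := by rw [h3]; exact Real.rpow_lt_rpow_of_exponent_lt hb1 hs3
  have hbu : (b:ℝ)^3 < (b:ℝ)^s * (b:ℝ)^u := by
    rw [h3, ← Real.rpow_add hb0]; exact Real.rpow_lt_rpow_of_exponent_lt hb1 (by linarith)
  have hl : 64 ≤ (b:ℝ)^(s-1+η) * b / (b:ℝ)^s := by
    have e : (b:ℝ)^(s-1+η) * b / (b:ℝ)^s = (b:ℝ)^η := by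
      rw [← Real.rpow_add_one hb0.ne', ← Real.rpow_sub hb0]; congr 1; ring
    rw [e, hbN]; push_cast
    rw [← Real.rpow_natCast, ← Real.rpow_mul (by norm_num)]
    calc (64:ℝ) = 4^(3:ℝ) := by norm_num
      _ ≤ _ := Real.rpow_le_rpow_of_exponent_le (by norm_num) hN2
  choose P hP0 hP hKT hcov using fun n => cover A (by linarith : 0 < s) hA (by omega : 2 ≤ b) n
  filter_upwards [cost_ae (N := N) hb hβ hβ3 hbu P hP hKT M] with θ hθ
  refine measure_mono_null (t := ⋃ n0 : ℕ, {z : Plane | ‖z‖ ≤ M ∧ ∀ n ≥ n0, ∃ k, n < k ∧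
      ((b:ℝ)^(s-1+η))^k < Nc b (P n k) k θ (pr θ (z 0) (z 1)) k}) ?_ ?_
  · rintro z ⟨hz1, hz2⟩
    rw [mem_iUnion]
    obtain ⟨n0, hn0⟩ := slice A (by omega : 2 ≤ b) (lam := (b:ℝ)^(s-1+η)) (by positivity)
      (by linarith : 0 < s - 1 + 2 * η)
      (Real.rpow_lt_rpow_of_exponent_lt hb1 (by linarith)) P hP0 hcov θ _ hz2
    exact ⟨n0, hz1, hn0⟩
  · rw [measure_iUnion_null_iff]
    intro n0
    have := det hN1 hbN hβ hu0 hl P hP M θ _ n0 (fun z hz => hz)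
    rw [hθ] at this
    exact nonpos_iff_eq_zero.1 this

end Heavy



namespace Heavy

/-- parametrisation of the circle -/
def circ (θ : ℝ) : Plane := !₂[Real.cos θ, Real.sin θ]

lemma circ_lip : LipschitzWith 2 circ := by
  apply LipschitzWith.of_dist_le_mul
  intro x y
  have h1 : |Real.cos x - Real.cos y| ≤ |x - y| := by
    simpa [Real.dist_eq] using Real.lipschitzWith_cos.dist_le_mul x y
  have h2 : |Real.sin x - Real.sin y| ≤ |x - y| := by
    simpa [Real.dist_eq] using Real.lipschitzWith_sin.dist_le_mul x y
  have := dist_le_pq 0 (circ x) (circ y) (c := |x - y|) (by simpa [circ, pr] using h2)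
    (by simpa [circ, qr] using h1)
  simpa [Real.dist_eq] using this

lemma circ_mem (θ : ℝ) : circ θ ∈ unitCircle := by
  unfold unitCircle circ
  rw [mem_sphere_zero_iff_norm, EuclideanSpace.norm_eq, Fin.sum_univ_two]
  simp

lemma exists_circ {e : Plane} (he : e ∈ unitCircle) :
    ∃ θ ∈ Ioc (-Real.pi) Real.pi, e = circ θ := by
  unfold unitCircle at he
  rw [mem_sphere_zero_iff_norm, EuclideanSpace.norm_eq, Fin.sum_univ_two, Real.sqrt_eq_one] at he
  simp only [Real.norm_eq_abs, sq_abs] at he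
  set c : ℂ := ⟨e 0, e 1⟩ with hc
  have hn : ‖c‖ = 1 := by
    rw [Complex.norm_def, Complex.normSq_mk, Real.sqrt_eq_one]; nlinarith
  have hc0 : c ≠ 0 := by intro h; rw [h] at hn; simp at hn
  refine ⟨c.arg, Complex.arg_mem_Ioc c, ?_⟩
  have h1 := Complex.cos_arg hc0
  have h2 := Complex.sin_arg c
  rw [hn, div_one] at h1 h2
  ext i
  fin_cases i
  · exact h1.symm
  · exact h2.symm

end Heavy

theorem statement2 (A : Set Plane) (t : ℝ)
    (ht : dimH A = ENNReal.ofReal t) (ht1 : 1 ≤ t) (ht2 : t ≤ 2) :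
    ∃ E : Set Plane, E ⊆ unitCircle ∧ μH[1] E = 0 ∧
      ∀ e ∈ unitCircle \ E,
        dimH {z | z ∈ A ∧ ENNReal.ofReal (t - 1) < dimH (A ∩ lineThrough e z)}
          ≤ ENNReal.ofReal (min (3 - t) t) := by
  set η : ℕ → ℝ := fun q => 1 / ((q:ℝ) + 2) with hη
  have hη0 : ∀ q, 0 < η q := fun q => by simp only [hη]; positivity
  have hη1 : ∀ q, η q ≤ 1/2 := fun q => by
    simp only [hη]
    apply one_div_le_one_div_of_le (by norm_num)
    have : (0:ℝ) ≤ q := by positivity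
    linarith
  have hηt : Filter.Tendsto η Filter.atTop (nhds 0) := by
    have := (tendsto_one_div_add_atTop_nhds_zero_nat (𝕜 := ℝ)).comp (Filter.tendsto_add_atTop_nat 1)
    refine this.congr fun q => ?_
    simp only [Function.comp, hη]; push_cast; ring
  have hA : ∀ q, μH[t + η q] A = 0 := by
    intro q
    have h0 : 0 ≤ t + η q := by linarith [hη0 q]
    have : dimH A < ((t + η q).toNNReal : ℝ≥0∞) := by
      rw [ht]
      exact (ENNReal.ofReal_lt_ofReal_iff (by linarith [hη0 q])).2 (by linarith [hη0 q])
    have := hausdorffMeasure_of_dimH_lt this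
    rwa [Real.coe_toNNReal _ h0] at this
  have hall : ∀ᵐ θ ∂(volume.restrict (Ioc (-Real.pi) Real.pi)), ∀ q p M : ℕ,
      μH[3 - t + η p] {z : Plane | ‖z‖ ≤ M ∧ μH[t + η q - 1 + 2 * η q]
        (A ∩ {w : Plane | Heavy.pr θ (w 0) (w 1) = Heavy.pr θ (z 0) (z 1)}) ≠ 0} = 0 := by
    rw [ae_all_iff]; intro q
    rw [ae_all_iff]; intro p
    rw [ae_all_iff]; intro M
    exact Heavy.main_null A (by linarith [hη0 q]) (by linarith [hη1 q]) (hη0 q) (hA q)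
      (by linarith [hη0 q, hη0 p]) M
  rw [ae_restrict_iff' measurableSet_Ioc, ae_iff] at hall
  refine ⟨Heavy.circ '' {θ | ¬ (θ ∈ Ioc (-Real.pi) Real.pi → ∀ q p M : ℕ,
      μH[3 - t + η p] {z : Plane | ‖z‖ ≤ M ∧ μH[t + η q - 1 + 2 * η q]
        (A ∩ {w : Plane | Heavy.pr θ (w 0) (w 1) = Heavy.pr θ (z 0) (z 1)}) ≠ 0} = 0)}, ?_, ?_, ?_⟩
  · rintro _ ⟨θ, _, rfl⟩; exact Heavy.circ_mem θ
  · have := Heavy.circ_lip.hausdorffMeasure_image_le (d := 1) zero_le_one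
      {θ | ¬ (θ ∈ Ioc (-Real.pi) Real.pi → ∀ q p M : ℕ,
      μH[3 - t + η p] {z : Plane | ‖z‖ ≤ M ∧ μH[t + η q - 1 + 2 * η q]
        (A ∩ {w : Plane | Heavy.pr θ (w 0) (w 1) = Heavy.pr θ (z 0) (z 1)}) ≠ 0} = 0)}
    rw [hausdorffMeasure_real, hall, mul_zero] at this
    exact nonpos_iff_eq_zero.1 this
  · rintro e ⟨he, heE⟩
    obtain ⟨θ, hθ, rfl⟩ := Heavy.exists_circ he
    have hgood : ∀ q p M : ℕ,
      μH[3 - t + η p] {z : Plane | ‖z‖ ≤ M ∧ μH[t + η q - 1 + 2 * η q]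
        (A ∩ {w : Plane | Heavy.pr θ (w 0) (w 1) = Heavy.pr θ (z 0) (z 1)}) ≠ 0} = 0 := by
      by_contra h
      exact heE ⟨θ, fun h' => h (h' hθ), rfl⟩
    rw [ENNReal.ofReal_min]
    refine le_min ?_ ((dimH_mono fun z hz => hz.1).trans ht.le)
    have hnull : ∀ p, μH[3 - t + η p]
        {z | z ∈ A ∧ ENNReal.ofReal (t - 1) < dimH (A ∩ lineThrough (Heavy.circ θ) z)} = 0 := by
      intro p
      refine measure_mono_null (t := ⋃ q : ℕ, ⋃ M : ℕ, {z : Plane | ‖z‖ ≤ M ∧ μH[t + η q - 1 + 2 * η q]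
        (A ∩ {w : Plane | Heavy.pr θ (w 0) (w 1) = Heavy.pr θ (z 0) (z 1)}) ≠ 0}) ?_ ?_
      · rintro z ⟨hzA, hz⟩
        have hlim : Filter.Tendsto (fun q => ENNReal.ofReal (t + η q - 1 + 2 * η q)) Filter.atTop
            (nhds (ENNReal.ofReal (t - 1))) := by
          apply ENNReal.tendsto_ofReal
          have := ((hηt.const_add t).sub_const 1).add (hηt.const_mul 2)
          simpa using this
        obtain ⟨q, hq⟩ := (hlim.eventually (gt_mem_nhds hz)).exists
        obtain ⟨M, hM⟩ := exists_nat_ge ‖z‖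
        rw [mem_iUnion]; refine ⟨q, ?_⟩
        rw [mem_iUnion]; refine ⟨M, hM, ?_⟩
        have h0 : 0 ≤ t + η q - 1 + 2 * η q := by linarith [hη0 q]
        have h1 := hausdorffMeasure_of_lt_dimH (show ((t + η q - 1 + 2 * η q).toNNReal : ℝ≥0∞) <
          dimH (A ∩ lineThrough (Heavy.circ θ) z) from hq)
        rw [Real.coe_toNNReal _ h0] at h1
        intro h2
        have h3 : μH[t + η q - 1 + 2 * η q] (A ∩ lineThrough (Heavy.circ θ) z) = 0 := by
          refine measure_mono_null (inter_subset_inter_right _ ?_) h2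
          rintro w ⟨r, rfl⟩
          simp only [mem_ofPred_eq, Heavy.pr, Heavy.circ]
          simp
          ring
        rw [h3] at h1
        exact ENNReal.zero_ne_top h1
      · rw [measure_iUnion_null_iff]; intro q
        rw [measure_iUnion_null_iff]; intro M
        exact hgood q p M
    have hlim : Filter.Tendsto (fun p => ENNReal.ofReal (3 - t + η p)) Filter.atTop
        (nhds (ENNReal.ofReal (3 - t))) := by
      apply ENNReal.tendsto_ofReal
      simpa using hηt.const_add (3 - t)
    refine ge_of_tendsto' hlim fun p => ?_
    have h0 : 0 ≤ 3 - t + η p := by linarith [hη0 p]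
    apply dimH_le_of_hausdorffMeasure_ne_top (d := (3 - t + η p).toNNReal)
    rw [Real.coe_toNNReal _ h0, hnull p]
    exact ENNReal.zero_ne_top
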